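/- Assume the continuum hypothesis. Then the collection of strongly meager subsets of 2^ω is not an ideal: there exist strongly meager sets X₁, X₂ ⊆ 2^ω such that X₁ ∪ X₂ is not strongly meager. -/

import Mathlib

open MeasureTheory Set Pointwise
open scoped ENNReal

/-- The Cantor space `2^ω = ℕ → ZMod 2`, with coordinatewise addition mod 2. -/
abbrev Cantor : Type := ℕ → ZMod 2

/-- The Haar probability measure on the Cantor space (equivalently, the product of
uniform measures on `ZMod 2`).  Applied to an arbitrary set it gives the outer measure,
so `μ H = 0` says that `H` has outer measure zero, i.e. `H` is null. -/
noncomputable def μ : Measure Cantor :=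
  Measure.addHaarMeasure ⟨⟨Set.univ, isCompact_univ⟩, by simp⟩

/-- A set `X ⊆ 2^ω` is strongly meager if `X + H ≠ 2^ω` for every null set `H`. -/
def StronglyMeager (X : Set Cantor) : Prop :=
  ∀ H : Set Cantor, μ H = 0 → X + H ≠ Set.univ
section QR
open ProbabilityTheory

/-- the product Bernoulli measure on subsets of `K` -/
noncomputable def bern (p : ℝ) : Measure Bool :=
  ENNReal.ofReal p • Measure.dirac true + ENNReal.ofReal (1 - p) • Measure.dirac false

lemma bern_prob {p : ℝ} (h0 : 0 ≤ p) (h1 : p ≤ 1) : IsProbabilityMeasure (bern p) := by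
  constructor
  simp only [bern, Measure.coe_add, Pi.add_apply, Measure.smul_apply, measure_univ, smul_eq_mul,
    mul_one]
  rw [← ENNReal.ofReal_add h0 (by linarith)]
  simp

lemma bern_true {p : ℝ} : bern p {true} = ENNReal.ofReal p := by
  simp [bern]

lemma bern_pi_true {K : Type*} [Fintype K] [DecidableEq K] {p : ℝ} (h0 : 0 ≤ p) (h1 : p ≤ 1)
    (U : Finset K) :
    Measure.pi (fun _ : K => bern p) {f | ∀ x ∈ U, f x = true} = ENNReal.ofReal p ^ U.card := by
  have := bern_prob h0 h1
  have : {f : K → Bool | ∀ x ∈ U, f x = true}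
      = Set.univ.pi (fun x => if x ∈ U then {true} else Set.univ) := by
    ext f
    simp only [Set.mem_ofPred_eq, Set.mem_pi, Set.mem_univ, true_implies]
    refine forall_congr' fun x => ?_
    by_cases hx : x ∈ U <;> simp [hx]
  rw [this, Measure.pi_pi]
  have h2 : ∀ x : K, bern p (if x ∈ U then {true} else Set.univ)
      = if x ∈ U then ENNReal.ofReal p else 1 := by
    intro x
    by_cases hx : x ∈ U
    · simp [hx, bern_true]
    · rw [if_neg hx, if_neg hx, measure_univ]
  simp_rw [h2]
  rw [Finset.prod_ite_mem]
  simp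

lemma hoeffding_sets {K : Type*} [AddCommGroup K] [Fintype K] [DecidableEq K] {p : ℝ}
    (h0 : 0 ≤ p) (h1 : p ≤ 1) (Z : Finset K) (C : Finset K)
    (hC : ∀ x ∈ C, ∀ y ∈ C, x ≠ y → Disjoint (Z.image (x + ·)) (Z.image (y + ·)))
    (τ : ℝ) (hτ : 0 ≤ τ) :
    (Measure.pi (fun _ : K => bern p)).real
      {f | τ * C.card < |((C.filter (fun x => ∀ z ∈ Z, f (x + z) = true)).card : ℝ)
        - p ^ Z.card * C.card|} ≤ 2 * Real.exp (- 2 * τ ^ 2 * C.card) := by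
  have := bern_prob h0 h1
  set P := Measure.pi (fun _ : K => bern p) with hP
  let e : C → Set (K → Bool) := fun x => {f | ∀ u ∈ Z.image (x.1 + ·), f u = true}
  have hme : ∀ x, MeasurableSet (e x) := fun x => (Set.toFinite _).measurableSet
  have hcardim : ∀ x : C, (Z.image (x.1 + ·)).card = Z.card := fun x =>
    Finset.card_image_of_injective _ (add_right_injective x.1)
  have hpe : ∀ x, P (e x) = ENNReal.ofReal p ^ Z.card := by
    intro x
    rw [hP, bern_pi_true h0 h1, hcardim]
  have hind : iIndepSet e P := by
    rw [iIndepSet_iff_meas_biInter hme]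
    intro S
    simp_rw [hpe]
    have : (⋂ i ∈ S, e i) = {f | ∀ u ∈ S.biUnion (fun x => Z.image (x.1 + ·)), f u = true} := by
      ext f
      simp only [e, Set.mem_iInter, Set.mem_ofPred_eq, Finset.mem_biUnion]
      exact ⟨fun h u ⟨a, ha, hu⟩ => h a ha u hu, fun h a ha u hu => h u ⟨a, ha, hu⟩⟩
    rw [this, hP, bern_pi_true h0 h1, Finset.card_biUnion]
    · simp_rw [hcardim]
      simp [← pow_mul, mul_comm]
    · intro x hx y hy hxy
      exact hC x x.2 y y.2 (fun h => hxy (Subtype.ext h))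
  have hif := hind.iIndepFun_indicator (β := ℝ) (m := inferInstance)
  have hmean : ∀ x, ∫ f, (e x).indicator (fun _ => (1:ℝ)) f ∂P = p ^ Z.card := by
    intro x
    rw [integral_indicator_const _ (hme x)]
    simp [Measure.real, hpe, h0]
  have hsub : ∀ x : C, HasSubgaussianMGF
      (fun f => (e x).indicator (fun _ => (1:ℝ)) f - p ^ Z.card) ((‖(1:ℝ) - 0‖₊ / 2) ^ 2) P := by
    intro x
    have := hasSubgaussianMGF_of_mem_Icc (μ := P) (a := 0) (b := 1)
      (X := fun f => (e x).indicator (fun _ => (1:ℝ)) f)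
      (measurable_const.indicator (hme x)).aemeasurable
      (Filter.Eventually.of_forall fun f => by
        by_cases hf : f ∈ e x <;> simp [hf])
    rwa [hmean x] at this
  have hsub' : ∀ x : C, HasSubgaussianMGF
      (fun f => -((e x).indicator (fun _ => (1:ℝ)) f - p ^ Z.card)) ((‖(1:ℝ) - 0‖₊ / 2) ^ 2) P :=
    fun x => (hsub x).neg
  have hi1 : iIndepFun (fun (x : C) f => (e x).indicator (fun _ => (1:ℝ)) f - p ^ Z.card) P :=
    hif.comp (fun _ t => t - p ^ Z.card) (fun _ => measurable_id.sub_const _)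
  have hi2 : iIndepFun (fun (x : C) f => -((e x).indicator (fun _ => (1:ℝ)) f - p ^ Z.card)) P :=
    hif.comp (fun _ t => -(t - p ^ Z.card)) (fun _ => (measurable_id.sub_const _).neg)
  have hb1 := HasSubgaussianMGF.measure_sum_ge_le_of_iIndepFun hi1 (s := Finset.univ)
    (fun x _ => hsub x) (ε := τ * C.card) (by positivity)
  have hb2 := HasSubgaussianMGF.measure_sum_ge_le_of_iIndepFun hi2 (s := Finset.univ)
    (fun x _ => hsub' x) (ε := τ * C.card) (by positivity)
  have hsum : ∀ f, ∑ x : C, ((e x).indicator (fun _ => (1:ℝ)) f - p ^ Z.card)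
      = ((C.filter (fun x => ∀ z ∈ Z, f (x + z) = true)).card : ℝ) - p ^ Z.card * C.card := by
    intro f
    rw [Finset.sum_sub_distrib]
    congr 1
    · rw [Finset.card_filter]
      push_cast
      rw [← Finset.sum_coe_sort C]
      refine Finset.sum_congr rfl fun x _ => ?_
      by_cases hx : ∀ z ∈ Z, f (x.1 + z) = true
      · rw [if_pos hx, Set.indicator_of_mem]
        exact Finset.forall_mem_image.2 hx
      · rw [if_neg hx, Set.indicator_of_notMem]
        exact fun h => hx (Finset.forall_mem_image.1 h)
    · simp [mul_comm]
  have hexp : Real.exp (-(τ * C.card) ^ 2 / (2 * ∑ _x : C, (((‖(1:ℝ) - 0‖₊ / 2) ^ 2 : NNReal) : ℝ)))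
      = Real.exp (- 2 * τ ^ 2 * C.card) := by
    congr 1
    simp only [Finset.sum_const, Finset.card_univ, Fintype.card_coe, nsmul_eq_mul]
    norm_num
    by_cases hc : (C.card : ℝ) = 0
    · simp [hc]
    · field_simp
      try ring
  push_cast at hb1 hb2 hexp
  rw [hexp] at hb1 hb2
  calc _ ≤ P.real ({f | τ * C.card ≤ ∑ x : C, ((e x).indicator (fun _ => (1:ℝ)) f - p ^ Z.card)} ∪
        {f | τ * C.card ≤ ∑ x : C, -((e x).indicator (fun _ => (1:ℝ)) f - p ^ Z.card)}) := by
        refine measureReal_mono ?_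
        intro f hf
        simp only [Set.mem_ofPred_eq, Set.mem_union, Finset.sum_neg_distrib, hsum] at hf ⊢
        rcases lt_abs.1 hf with h | h
        · left; exact h.le
        · right; exact h.le
    _ ≤ _ := (measureReal_union_le _ _).trans (by linarith)


abbrev FK (m : ℕ) : Type := Fin m → ZMod 2

lemma exists_spread {m : ℕ} (Z : Finset (FK m)) :
    ∃ C : Finset (FK m), 2 ^ m ≤ C.card * (Z.card ^ 2 + 1) ∧
      ∀ x ∈ C, ∀ y ∈ C, x ≠ y → ∀ z ∈ Z, ∀ z' ∈ Z, x + z ≠ y + z' := by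
  classical
  let Δ : Finset (FK m) := insert 0 ((Z ×ˢ Z).image fun a => a.1 - a.2)
  let S : Set (Submodule (ZMod 2) (FK m)) := {W | ∀ v ∈ Δ, v ∈ W → v = 0}
  have hS : S.Nonempty := ⟨⊥, fun v _ hv => by simpa using hv⟩
  obtain ⟨W, hW⟩ := (Set.toFinite S).exists_maximal hS
  have key : ∀ v : (FK m), ∃ δ ∈ Δ, ∃ w ∈ W, v = w + δ := by
    intro v
    by_cases hv : v ∈ W
    · exact ⟨0, by simp [Δ], v, hv, by simp⟩
    · have hlt : W < W ⊔ Submodule.span (ZMod 2) {v} := by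
        refine lt_of_le_of_ne le_sup_left fun h => hv ?_
        rw [h]
        exact Submodule.mem_sup_right (Submodule.mem_span_singleton_self v)
      have hnot : (W ⊔ Submodule.span (ZMod 2) {v}) ∉ S := fun h =>
        absurd (hW.2 h hlt.le) (not_le_of_gt hlt)
      simp only [S, Set.mem_ofPred_eq, not_forall] at hnot
      obtain ⟨δ, hδ, hδm, hδ0⟩ := hnot
      obtain ⟨w, hw, u, hu, hwu⟩ := Submodule.mem_sup.1 hδm
      obtain ⟨a, rfl⟩ := Submodule.mem_span_singleton.1 hu
      have ha : a = 0 ∨ a = 1 := by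
        clear hu hwu; revert a; decide
      rcases ha with rfl | rfl
      · exfalso
        apply hδ0
        apply hW.1 δ hδ
        rw [← hwu]; simpa using hw
      · refine ⟨δ, hδ, -w, W.neg_mem hw, ?_⟩
        rw [← hwu, one_smul]; abel
  refine ⟨Finset.univ.filter (· ∈ W), ?_, ?_⟩
  · have hsub : (Finset.univ : Finset (FK m)) ⊆
        ((Finset.univ.filter (· ∈ W)) ×ˢ Δ).image fun a => a.1 + a.2 := by
      intro v _
      obtain ⟨δ, hδ, w, hw, rfl⟩ := key v
      exact Finset.mem_image.2 ⟨(w, δ), by simp [hw, hδ], rfl⟩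
    have h1 := Finset.card_le_card hsub
    have h2 : (Finset.univ : Finset (FK m)).card = 2 ^ m := by simp [FK]
    rw [h2] at h1
    refine h1.trans (Finset.card_image_le.trans ?_)
    rw [Finset.card_product]
    refine Nat.mul_le_mul_left _ ?_
    refine (Finset.card_insert_le _ _).trans ?_
    refine Nat.add_le_add_right (Finset.card_image_le.trans ?_) 1
    rw [Finset.card_product, sq]
  · intro x hx y hy hxy z hz z' hz' h
    simp only [Finset.mem_filter, Finset.mem_univ, true_and] at hx hy
    have h3 : x - y = z' - z := by
      rw [sub_eq_sub_iff_add_eq_add, h, add_comm]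
    have h4 : x - y = 0 := by
      apply hW.1 (x - y) _ (W.sub_mem hx hy)
      rw [h3]
      refine Finset.mem_insert_of_mem (Finset.mem_image.2 ⟨(z', z), by simp [hz, hz'], rfl⟩)
    exact hxy (sub_eq_zero.1 h4)

/-- Points all of whose `Z`-translates are in `A`. -/
def sh {K : Type*} [AddCommGroup K] [Fintype K] [DecidableEq K] (A Z : Finset K) : Finset K :=
  Finset.univ.filter fun x => ∀ z ∈ Z, x + z ∈ A

lemma exists_small (k : ℕ) (c : ℝ) (hc : 0 < c) (Q : ℕ) :
    ∃ m : ℕ, Q ≤ 2 ^ m ∧ ((2:ℝ) ^ m) ^ (k + 1) * (2 * Real.exp (- c * 2 ^ m)) < 1 := by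
  have h1 := Real.tendsto_pow_mul_exp_neg_atTop_nhds_zero (k + 1)
  have h2 : Filter.Tendsto (fun m : ℕ => c * (2:ℝ) ^ m) Filter.atTop Filter.atTop :=
    (tendsto_pow_atTop_atTop_of_one_lt (by norm_num)).const_mul_atTop hc
  have h3 := h1.comp h2
  have h4 : ∀ᶠ m : ℕ in Filter.atTop, (c * (2:ℝ) ^ m) ^ (k + 1) * Real.exp (-(c * (2:ℝ) ^ m))
      < c ^ (k + 1) / 2 := h3.eventually_lt_const (by positivity)
  have h5 : ∀ᶠ m : ℕ in Filter.atTop, Q ≤ 2 ^ m :=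
    (tendsto_pow_atTop_atTop_of_one_lt (by norm_num)).eventually_ge_atTop Q
  obtain ⟨m, hm1, hm2⟩ := (h4.and h5).exists
  refine ⟨m, hm2, ?_⟩
  rw [mul_pow] at hm1
  have hcp : (0:ℝ) < c ^ (k+1) := by positivity
  rw [neg_mul]
  by_contra hcon
  push Not at hcon
  nlinarith

theorem exists_QR (k : ℕ) (p τ : ℝ) (h0 : 0 ≤ p) (h1 : p ≤ 1) (hτ : 0 < τ) (Q : ℕ) :
    ∃ m : ℕ, Q ≤ 2 ^ m ∧ ∃ A : Finset (FK m), ∀ Z : Finset (FK m),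
      Z.card ≤ k → |((sh A Z).card : ℝ) - p ^ Z.card * 2 ^ m| ≤ τ * 2 ^ m := by
  classical
  set c : ℝ := 2 * τ ^ 2 / (k ^ 2 + 1) with hc
  obtain ⟨m, hmQ, hm⟩ := exists_small k c (by positivity) Q
  refine ⟨m, hmQ, ?_⟩
  have hKc : Fintype.card (FK m) = 2 ^ m := by simp [FK]
  choose C hC1 hC2 using fun Z : Finset (FK m) => exists_spread Z
  have := bern_prob h0 h1
  set P := Measure.pi (fun _ : (FK m) => bern p) with hP
  let Zf : (Fin k → (FK m)) → Finset (FK m) := fun φ => Finset.univ.image φ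
  have hZf : ∀ φ, (Zf φ).card ≤ k := fun φ => Finset.card_image_le.trans (by simp)
  let tr : (FK m) → Finset (FK m) → Finset (FK m) := fun g Z => Z.image (g + ·)
  have htr : ∀ g Z, (tr g Z).card = Z.card := fun g Z =>
    Finset.card_image_of_injective _ (add_right_injective g)
  let Bad : (Fin k → (FK m)) × (FK m) → Set ((FK m) → Bool) := fun a =>
    {f | τ * (C (Zf a.1)).card < |(((C (Zf a.1)).filter
        (fun x => ∀ z ∈ tr a.2 (Zf a.1), f (x + z) = true)).card : ℝ)
        - p ^ (tr a.2 (Zf a.1)).card * (C (Zf a.1)).card|}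
  have hBad : ∀ a, P.real (Bad a) ≤ 2 * Real.exp (- c * 2 ^ m) := by
    intro a
    refine (hoeffding_sets h0 h1 (tr a.2 (Zf a.1)) (C (Zf a.1)) ?_ τ hτ.le).trans ?_
    · intro x hx y hy hxy
      rw [Finset.disjoint_left]
      intro u hu hu'
      simp only [tr, Finset.mem_image] at hu hu'
      obtain ⟨_, ⟨z, hz, rfl⟩, rfl⟩ := hu
      obtain ⟨_, ⟨z', hz', rfl⟩, h⟩ := hu'
      apply hC2 _ x hx y hy hxy z hz z' hz'
      have : a.2 + (y + z') = a.2 + (x + z) := by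
        rw [add_left_comm, h, add_left_comm]
      exact (add_left_cancel this).symm
    · have h2 : (2:ℝ) ^ m ≤ (C (Zf a.1)).card * (k ^ 2 + 1) := by
        have h3 : 2 ^ m ≤ (C (Zf a.1)).card * (k ^ 2 + 1) := (hC1 (Zf a.1)).trans
          (Nat.mul_le_mul_left _ (Nat.add_le_add_right (Nat.pow_le_pow_left (hZf _) 2) 1))
        exact_mod_cast h3
      have h4 : c * 2 ^ m ≤ 2 * τ ^ 2 * (C (Zf a.1)).card := by
        rw [hc, div_mul_eq_mul_div, div_le_iff₀ (by positivity), mul_assoc (2 * τ ^ 2)]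
        exact mul_le_mul_of_nonneg_left h2 (by positivity)
      have := Real.exp_le_exp.2 (show - 2 * τ ^ 2 * ((C (Zf a.1)).card : ℝ) ≤ -c * 2 ^ m by linarith)
      linarith
  have hex : ∃ f, f ∉ ⋃ a, Bad a := by
    by_contra hcon
    push Not at hcon
    have hun : (⋃ a, Bad a) = Set.univ := Set.eq_univ_of_forall hcon
    have h2 : P.real (⋃ a, Bad a) = 1 := by rw [hun]; simp [hP]
    have h3 := measureReal_iUnion_fintype_le (μ := P) Bad
    have h4 : ∑ a, P.real (Bad a) ≤ ∑ _a : (Fin k → (FK m)) × (FK m), 2 * Real.exp (- c * 2 ^ m) :=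
      Finset.sum_le_sum fun a _ => hBad a
    rw [Finset.sum_const, nsmul_eq_mul, Finset.card_univ, Fintype.card_prod, Fintype.card_fun,
      Fintype.card_fin, hKc] at h4
    push_cast at h4
    rw [← pow_succ] at h4
    linarith
  obtain ⟨f, hf⟩ := hex
  simp only [Set.mem_iUnion, not_exists, Bad, Set.mem_ofPred_eq, not_lt] at hf
  refine ⟨Finset.univ.filter (fun x => f x = true), fun Z hZ => ?_⟩
  rcases Z.eq_empty_or_nonempty with rfl | ⟨z0, hz0⟩
  · simp [sh]; positivity
  have hφ : ∃ φ : Fin k → (FK m), Zf φ = Z := by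
    refine ⟨fun i => if h : i.1 < Z.card then (Z.equivFin.symm ⟨i.1, h⟩).1 else z0, ?_⟩
    ext u
    simp only [Zf, Finset.mem_image, Finset.mem_univ, true_and]
    constructor
    · rintro ⟨i, rfl⟩
      split_ifs
      · exact (Z.equivFin.symm _).2
      · exact hz0
    · intro hu
      have hlt := (Z.equivFin ⟨u, hu⟩).2
      refine ⟨⟨(Z.equivFin ⟨u, hu⟩).1, hlt.trans_le hZ⟩, ?_⟩
      rw [dif_pos hlt]
      simp
  obtain ⟨φ, rfl⟩ := hφ
  set Z := Zf φ with hZdef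
  have hg : ∀ g : (FK m), |(((C Z).filter (fun x => g + x ∈ sh (Finset.univ.filter (fun x => f x = true)) Z)).card : ℝ)
        - p ^ Z.card * (C Z).card| ≤ τ * (C Z).card := by
    intro g
    have h2 := hf (φ, g)
    simp only [htr] at h2
    have h3 : ((C Z).filter (fun x => g + x ∈ sh (Finset.univ.filter (fun x => f x = true)) Z))
      = (C Z).filter (fun x => ∀ z ∈ tr g Z, f (x + z) = true) := ?_
    · rw [h3]; exact h2
    apply Finset.filter_congr
    intro x _
    simp only [sh, tr, Finset.mem_filter, Finset.mem_univ, true_and, Finset.forall_mem_image]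
    refine forall_congr' fun z => forall_congr' fun _ => ?_
    rw [show g + x + z = x + (g + z) by abel]
  have hcount : ∑ g : (FK m), (((C Z).filter (fun x => g + x ∈
      sh (Finset.univ.filter (fun x => f x = true)) Z)).card : ℝ)
      = (C Z).card * (sh (Finset.univ.filter (fun x => f x = true)) Z).card := by
    simp_rw [Finset.card_filter]
    push_cast
    rw [Finset.sum_comm]
    rw [← nsmul_eq_mul, ← Finset.sum_const]
    refine Finset.sum_congr rfl fun x _ => ?_
    rw [Fintype.sum_equiv (Equiv.addRight x) _
      (fun u => if u ∈ sh (Finset.univ.filter (fun x => f x = true)) Z then (1:ℝ) else 0)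
      (fun g => by simp only [Equiv.coe_addRight]; congr)]
    simp
  have hCpos : (0:ℝ) < (C Z).card := by
    have h3 := hC1 Z
    have : 0 < (C Z).card := by
      by_contra h
      have : (C Z).card = 0 := by omega
      rw [this] at h3
      simp at h3
    exact_mod_cast this
  have hsum := Finset.abs_sum_le_sum_abs (fun g : (FK m) => (((C Z).filter (fun x => g + x ∈
      sh (Finset.univ.filter (fun x => f x = true)) Z)).card : ℝ)
        - p ^ Z.card * (C Z).card) Finset.univ
  have hsum2 := hsum.trans (Finset.sum_le_sum fun g _ => hg g)
  rw [Finset.sum_sub_distrib, hcount, Finset.sum_const, Finset.sum_const, Finset.card_univ,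
    hKc] at hsum2
  simp only [nsmul_eq_mul] at hsum2
  push_cast at hsum2
  rw [show ((C Z).card : ℝ) * ((sh (Finset.univ.filter (fun x => f x = true)) Z).card : ℝ)
    - 2 ^ m * (p ^ Z.card * (C Z).card) = (C Z).card *
      (((sh (Finset.univ.filter (fun x => f x = true)) Z).card : ℝ) - p ^ Z.card * 2 ^ m) by ring,
    abs_mul, abs_of_pos hCpos] at hsum2
  refine le_of_mul_le_mul_left (hsum2.trans (le_of_eq ?_)) hCpos
  ring

end QR

section Comb
variable {K : Type*} [AddCommGroup K] [Fintype K] [DecidableEq K]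

lemma mem_sh {A Z : Finset K} {x : K} : x ∈ sh A Z ↔ ∀ z ∈ Z, x + z ∈ A := by
  simp [sh]

lemma sh_union (A Z W : Finset K) : sh A (Z ∪ W) = sh A Z ∩ sh A W := by
  ext x
  simp only [mem_sh, Finset.mem_union, Finset.mem_inter]
  exact ⟨fun h => ⟨fun z hz => h z (Or.inl hz), fun z hz => h z (Or.inr hz)⟩,
    fun h z hz => hz.elim (h.1 z) (h.2 z)⟩

lemma max_family {α : Type*} [DecidableEq α] (S : Finset α) (r : α → α → Prop)
    (hr : ∀ a b, r a b → r b a) :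
    ∃ Y ⊆ S, (∀ a ∈ Y, ∀ b ∈ Y, a ≠ b → r a b) ∧ ∀ a ∈ S, a ∈ Y ∨ ∃ b ∈ Y, ¬ r a b := by
  classical
  let F : Finset (Finset α) := S.powerset.filter fun Y => ∀ a ∈ Y, ∀ b ∈ Y, a ≠ b → r a b
  have hF : F.Nonempty := ⟨∅, by simp [F]⟩
  obtain ⟨Y, hYF, hmax⟩ := Finset.exists_max_image F Finset.card hF
  simp only [F, Finset.mem_filter, Finset.mem_powerset] at hYF hmax
  refine ⟨Y, hYF.1, hYF.2, fun a ha => ?_⟩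
  by_contra hcon
  push Not at hcon
  obtain ⟨haY, hall⟩ := hcon
  have := hmax (insert a Y) ⟨Finset.insert_subset ha hYF.1, ?_⟩
  · rw [Finset.card_insert_of_notMem haY] at this
    omega
  · intro u hu v hv huv
    rcases Finset.mem_insert.1 hu with hu1 | hu1 <;> rcases Finset.mem_insert.1 hv with hv1 | hv1
    · exact absurd (hu1.trans hv1.symm) huv
    · exact hu1 ▸ hall v hv1
    · exact hv1 ▸ hr _ _ (hall u hu1)
    · exact hYF.2 u hu1 v hv1 huv

/-- Quasirandomness. -/
def QRand (A : Finset K) (N : ℕ) (ε τ : ℝ) : Prop :=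
  ∀ Z : Finset K, Z.card ≤ N →
    |((sh A Z).card : ℝ) - ε ^ Z.card * Fintype.card K| ≤ τ * Fintype.card K

set_option maxHeartbeats 1000000 in
lemma spread_bound {α : Type*} {A : Finset K} {k s : ℕ} {ε δ τ : ℝ} (hε0 : 0 < ε) (hε1 : ε ≤ 1)
    (hδ : 0 < δ) (hA : QRand A (3 * k) ε τ) (hτ : 8 * τ ≤ δ ^ 2 * ε ^ (6 * k))
    (T D : Finset K) (Y : Finset α) (Z : α → Finset K)
    (hdisj : ∀ a ∈ Y, ∀ b ∈ Y, a ≠ b → Disjoint (Z a) (Z b))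
    (hT : ∀ a ∈ Y, Disjoint T (Z a)) (hs : ∀ a ∈ Y, (Z a).card = s)
    (ht : T.card + 2 * s ≤ 3 * k)
    (hD : ((D ∩ sh A T).card : ℝ) ≤ δ * ε ^ T.card * Fintype.card K)
    (hbad : ∀ a ∈ Y, 2 * δ * ε ^ (T.card + s) * Fintype.card K <
      ((D ∩ sh A (T ∪ Z a)).card : ℝ)) :
    (Y.card : ℝ) * (δ ^ 2 * ε ^ (6 * k)) ≤ 2 := by
  classical
  set q : ℝ := ((Fintype.card K : ℕ) : ℝ) with hq
  have hq0 : 0 < q := by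
    have : 0 < Fintype.card K := Fintype.card_pos
    rw [hq]; exact_mod_cast this
  have hτ0 : 0 ≤ τ := by
    have := (abs_nonneg _).trans (hA ∅ (by simp))
    exact nonneg_of_mul_nonneg_left this hq0
  let g : Finset K → K → ℝ := fun Z x => if x ∈ sh A Z then 1 else 0
  let f : α → K → ℝ := fun a x => g (Z a) x - ε ^ s
  have hεs : ε ^ s ≤ 1 := pow_le_one₀ hε0.le hε1
  have hεs0 : 0 < ε ^ s := by positivity
  -- sums of g over T
  have hgsum : ∀ (E W : Finset K), ∑ x ∈ E, g W x = ((E ∩ sh A W).card : ℝ) := by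
    intro E W
    simp only [g]
    rw [Finset.sum_boole, Finset.filter_mem_eq_inter]
  have hgT : ∀ W, ∑ x ∈ sh A T, g W x = ((sh A (T ∪ W)).card : ℝ) := by
    intro W
    rw [hgsum, ← sh_union]
  set w : ℝ := ((Y.card : ℕ) : ℝ) with hw
  -- lower bound
  set D' := D ∩ sh A T with hD'
  have hlow : w * (δ * ε ^ (T.card + s) * q) ≤ ∑ x ∈ D', ∑ a ∈ Y, f a x := by
    rw [Finset.sum_comm, hw, ← nsmul_eq_mul, ← Finset.sum_const]
    refine Finset.sum_le_sum fun a ha => ?_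
    simp only [f]
    rw [Finset.sum_sub_distrib, hgsum, Finset.sum_const, nsmul_eq_mul, hD', Finset.inter_assoc,
      ← sh_union]
    have h1 := hbad a ha
    have h2 := mul_le_mul_of_nonneg_right hD hεs0.le
    rw [pow_add] at h1 ⊢
    nlinarith
  have hCS : (∑ x ∈ D', ∑ a ∈ Y, f a x) ^ 2 ≤ q * ∑ x ∈ sh A T, (∑ a ∈ Y, f a x) ^ 2 := by
    refine sq_sum_le_card_mul_sum_sq.trans ?_
    refine mul_le_mul ?_ ?_ (Finset.sum_nonneg fun _ _ => sq_nonneg _) hq0.le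
    · rw [hq]; exact_mod_cast Finset.card_le_univ _
    · exact Finset.sum_le_sum_of_subset_of_nonneg Finset.inter_subset_right
        fun _ _ _ => sq_nonneg _
  have hoff : ∀ a ∈ Y, ∀ b ∈ Y, ∑ x ∈ sh A T, f a x * f b x ≤ (if a = b then q else 0) + 4 * τ * q := by
    intro a ha b hb
    by_cases hab : a = b
    · subst hab
      rw [if_pos rfl]
      have : ∑ x ∈ sh A T, f a x * f a x ≤ ∑ x ∈ sh A T, (1:ℝ) := by
        refine Finset.sum_le_sum fun x _ => ?_
        simp only [f, g]
        split_ifs <;> nlinarith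
      have h2 : ∑ x ∈ sh A T, (1:ℝ) ≤ q := by
        rw [Finset.sum_const, nsmul_eq_mul, mul_one, hq]
        exact_mod_cast Finset.card_le_univ _
      have : 0 ≤ 4 * τ * q := by positivity
      linarith
    · rw [if_neg hab, zero_add]
      have hprod : ∀ x, f a x * f b x = g (Z a ∪ Z b) x - ε ^ s * g (Z a) x - ε ^ s * g (Z b) x
          + ε ^ s * ε ^ s := by
        intro x
        have : g (Z a ∪ Z b) x = g (Z a) x * g (Z b) x := by
          simp only [g, sh_union, Finset.mem_inter]
          split_ifs <;> simp_all
        simp only [f]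
        rw [this]; ring
      simp only [hprod]
      rw [Finset.sum_add_distrib, Finset.sum_sub_distrib, Finset.sum_sub_distrib,
        ← Finset.mul_sum, ← Finset.mul_sum, hgT, hgT, hgT, Finset.sum_const, nsmul_eq_mul]
      have ca : (T ∪ Z a).card = T.card + s := by
        rw [Finset.card_union_of_disjoint (hT a ha), hs a ha]
      have cb : (T ∪ Z b).card = T.card + s := by
        rw [Finset.card_union_of_disjoint (hT b hb), hs b hb]
      have cab : (T ∪ (Z a ∪ Z b)).card = T.card + (s + s) := by
        rw [Finset.card_union_of_disjoint, Finset.card_union_of_disjoint (hdisj a ha b hb hab),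
          hs a ha, hs b hb]
        exact Finset.disjoint_union_right.2 ⟨hT a ha, hT b hb⟩
      have e1 := (abs_le.1 (hA (T ∪ (Z a ∪ Z b)) (by omega))).2
      have e2 := (abs_le.1 (hA (T ∪ Z a) (by omega))).1
      have e3 := (abs_le.1 (hA (T ∪ Z b) (by omega))).1
      have e4 := (abs_le.1 (hA T (by omega))).2
      rw [cab] at e1; rw [ca] at e2; rw [cb] at e3
      rw [pow_add, pow_add] at e1
      rw [pow_add] at e2 e3
      rw [← hq] at e1 e2 e3 e4
      have hτq : 0 ≤ τ * q := by positivity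
      have m2 := mul_le_mul_of_nonneg_left e2 hεs0.le
      have m3 := mul_le_mul_of_nonneg_left e3 hεs0.le
      have hss : ε ^ s * ε ^ s ≤ 1 := by nlinarith
      have m4 := mul_le_mul_of_nonneg_left e4 (mul_pos hεs0 hεs0).le
      have n2 : ε ^ s * (τ * q) ≤ τ * q := by nlinarith
      have n4 : ε ^ s * ε ^ s * (τ * q) ≤ τ * q := by nlinarith
      nlinarith
  have hsq : ∑ x ∈ sh A T, (∑ a ∈ Y, f a x) ^ 2 ≤ w * q + w ^ 2 * (4 * τ * q) := by
    have : ∑ x ∈ sh A T, (∑ a ∈ Y, f a x) ^ 2 = ∑ a ∈ Y, ∑ b ∈ Y, ∑ x ∈ sh A T, f a x * f b x := by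
      simp only [sq, Finset.sum_mul_sum]
      rw [Finset.sum_comm]
      exact Finset.sum_congr rfl fun a _ => Finset.sum_comm
    rw [this]
    refine (Finset.sum_le_sum fun a ha => Finset.sum_le_sum fun b hb => hoff a ha b hb).trans ?_
    apply le_of_eq
    simp only [Finset.sum_add_distrib, Finset.sum_const, nsmul_eq_mul, Finset.sum_ite_eq]
    rw [Finset.sum_ite_mem, Finset.inter_self, Finset.sum_const, nsmul_eq_mul, ← hw]
    ring
  have hpow : ε ^ (6 * k) ≤ (ε ^ (T.card + s)) ^ 2 := by
    rw [← pow_mul]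
    exact pow_le_pow_of_le_one hε0.le hε1 (by omega)
  have hw0 : 0 ≤ w := by positivity
  have hfin : (w * (δ * ε ^ (T.card + s) * q)) ^ 2 ≤ q * (w * q + w ^ 2 * (4 * τ * q)) :=
    (pow_le_pow_left₀ (by positivity) hlow 2).trans
      (hCS.trans (mul_le_mul_of_nonneg_left hsq hq0.le))
  rcases hw0.eq_or_lt with h0 | hwpos
  · rw [← h0]; norm_num
  have h5 : w * q ^ 2 * (w * (δ ^ 2 * (ε ^ (T.card + s)) ^ 2)) ≤ w * q ^ 2 * (1 + w * (4 * τ)) := by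
    calc _ = (w * (δ * ε ^ (T.card + s) * q)) ^ 2 := by ring
      _ ≤ _ := hfin
      _ = _ := by ring
  have h6 := le_of_mul_le_mul_left h5 (by positivity)
  have h7 : w * (δ ^ 2 * ε ^ (6 * k)) ≤ w * (δ ^ 2 * (ε ^ (T.card + s)) ^ 2) := by gcongr
  nlinarith

end Comb

section Comb2
variable {K : Type*} [AddCommGroup K] [Fintype K] [DecidableEq K]

lemma image_inter_sh (A B T : Finset K) (y : K) :
    (B.image (· + y)) ∩ sh A T = (B ∩ sh A (T.image (· + y))).image (· + y) := by
  ext x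
  simp only [Finset.mem_inter, Finset.mem_image, mem_sh]
  constructor
  · rintro ⟨⟨u, hu, rfl⟩, h⟩
    refine ⟨u, ⟨hu, ?_⟩, rfl⟩
    rintro _ ⟨t, ht, rfl⟩
    have := h t ht
    rwa [add_assoc, add_comm y t] at this
  · rintro ⟨u, ⟨hu, h⟩, rfl⟩
    refine ⟨⟨u, hu, rfl⟩, fun t ht => ?_⟩
    rw [add_assoc, add_comm y t]
    exact h _ ⟨t, ht, rfl⟩

lemma bad_translates {A : Finset K} {k w : ℕ} {ε δ τ : ℝ} (hε0 : 0 < ε) (hε1 : ε ≤ 1)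
    (hδ : 0 < δ) (hA : QRand A (3 * k) ε τ) (hτ : 8 * τ ≤ δ ^ 2 * ε ^ (6 * k))
    (hw : 2 ≤ (w : ℝ) * (δ ^ 2 * ε ^ (6 * k)))
    (T B : Finset K) (hT : T.card ≤ k) (hB : (B.card : ℝ) ≤ δ * Fintype.card K) :
    (Finset.univ.filter fun y : K => 2 * δ * ε ^ T.card * Fintype.card K <
      ((B.image (· + y) ∩ sh A T).card : ℝ)).card ≤ w * (k ^ 2 + 1) := by
  classical
  set S := Finset.univ.filter fun y : K => 2 * δ * ε ^ T.card * Fintype.card K <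
      ((B.image (· + y) ∩ sh A T).card : ℝ) with hS
  obtain ⟨Y, hYS, hY1, hY2⟩ := max_family S
    (fun y y' => Disjoint (T.image (· + y)) (T.image (· + y'))) (fun _ _ h => h.symm)
  have hYw : Y.card ≤ w := by
    have h1 := spread_bound (s := T.card) hε0 hε1 hδ hA hτ ∅ B Y (fun y => T.image (· + y)) hY1
      (by simp) (fun y _ => Finset.card_image_of_injective _ (add_left_injective y))
      (by simp; omega) (by
        simp only [Finset.card_empty, pow_zero, mul_one]
        exact le_trans (by exact_mod_cast Finset.card_le_card Finset.inter_subset_left) hB) (by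
        intro y hy
        have := (Finset.mem_filter.1 (hYS hy)).2
        rw [image_inter_sh, Finset.card_image_of_injective _ (add_left_injective y)] at this
        simpa using this)
    have hpos : 0 < δ ^ 2 * ε ^ (6 * k) := by positivity
    have : (Y.card : ℝ) ≤ w := le_of_mul_le_mul_right (h1.trans hw) hpos
    exact_mod_cast this
  have hsub : S ⊆ Y ∪ (Y ×ˢ (T ×ˢ T)).image (fun a => a.1 + a.2.1 - a.2.2) := by
    intro y hy
    rcases hY2 y hy with h | ⟨y', hy', h⟩
    · exact Finset.mem_union_left _ h
    · rw [Finset.not_disjoint_iff] at h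
      obtain ⟨u, h1, h2⟩ := h
      obtain ⟨t, ht, rfl⟩ := Finset.mem_image.1 h1
      obtain ⟨t', ht', h3⟩ := Finset.mem_image.1 h2
      refine Finset.mem_union_right _ (Finset.mem_image.2 ⟨(y', t', t), by simp [hy', ht, ht'], ?_⟩)
      simp only at h3 ⊢
      rw [add_comm y', h3]; abel
  refine (Finset.card_le_card hsub).trans ((Finset.card_union_le _ _).trans ?_)
  have h4 : ((Y ×ˢ (T ×ˢ T)).image (fun a => a.1 + a.2.1 - a.2.2)).card ≤ w * k ^ 2 := by
    refine Finset.card_image_le.trans ?_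
    rw [Finset.card_product, Finset.card_product, sq]
    gcongr
  nlinarith

lemma core_sets {A : Finset K} {k w : ℕ} {ε δ τ : ℝ} (hε0 : 0 < ε) (hε1 : ε ≤ 1)
    (hδ : 0 < δ) (hA : QRand A (3 * k) ε τ) (hτ : 8 * τ ≤ δ ^ 2 * ε ^ (6 * k))
    (hw : 2 ≤ (w : ℝ) * (δ ^ 2 * ε ^ (6 * k)))
    (T D : Finset K)
    (hD : ∀ T' ⊆ T, T'.card ≤ k → ((D ∩ sh A T').card : ℝ) ≤ δ * ε ^ T'.card * Fintype.card K) :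
    ∃ V : Finset K, Disjoint V T ∧ V.card ≤ 2 ^ T.card * ((k + 1) * (w * k)) ∧
      ∀ Z : Finset K, Disjoint Z V → Z.card ≤ k →
        ((D ∩ sh A Z).card : ℝ) ≤ 2 * δ * ε ^ Z.card * Fintype.card K := by
  classical
  let S : Finset K → ℕ → Finset (Finset K) := fun T' s => Finset.univ.filter fun Z =>
    Disjoint T Z ∧ Z.card = s ∧ 2 * δ * ε ^ (T'.card + s) * Fintype.card K <
      ((D ∩ sh A (T' ∪ Z)).card : ℝ)
  choose Y hYS hY1 hY2 using fun T' s => max_family (S T' s)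
    (fun Z Z' => Disjoint Z Z') (fun _ _ h => h.symm)
  have hYw : ∀ T' ⊆ T, ∀ s, T'.card + s ≤ k → (Y T' s).card ≤ w := by
    intro T' hT' s hs
    have h1 := spread_bound (s := s) hε0 hε1 hδ hA hτ T' D (Y T' s) (fun Z => Z) (hY1 T' s)
      (fun Z hZ => (Finset.mem_filter.1 (hYS _ _ hZ)).2.1.mono_left hT')
      (fun Z hZ => (Finset.mem_filter.1 (hYS _ _ hZ)).2.2.1) (by omega)
      (hD T' hT' (by omega))
      (fun Z hZ => (Finset.mem_filter.1 (hYS _ _ hZ)).2.2.2)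
    have hpos : 0 < δ ^ 2 * ε ^ (6 * k) := by positivity
    have : ((Y T' s).card : ℝ) ≤ w := le_of_mul_le_mul_right (h1.trans hw) hpos
    exact_mod_cast this
  let I : Finset (Finset K × ℕ) := (T.powerset ×ˢ Finset.range (k + 1)).filter
    fun a => a.1.card + a.2 ≤ k
  refine ⟨I.biUnion fun a => (Y a.1 a.2).biUnion id, ?_, ?_, ?_⟩
  · rw [Finset.disjoint_biUnion_left]
    intro a _
    rw [Finset.disjoint_biUnion_left]
    intro Z hZ
    exact (Finset.mem_filter.1 (hYS _ _ hZ)).2.1.symm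
  · have hI : I.card ≤ 2 ^ T.card * (k + 1) := by
      refine (Finset.card_filter_le _ _).trans ?_
      rw [Finset.card_product, Finset.card_powerset, Finset.card_range]
    refine (Finset.card_biUnion_le_card_mul _ _ (w * k) ?_).trans ?_
    · intro a ha
      simp only [I, Finset.mem_filter, Finset.mem_product, Finset.mem_powerset,
        Finset.mem_range] at ha
      refine (Finset.card_biUnion_le_card_mul _ _ k ?_).trans
        (Nat.mul_le_mul_right _ (hYw a.1 ha.1.1 a.2 ha.2))
      intro Z hZ
      have := (Finset.mem_filter.1 (hYS _ _ hZ)).2.2.1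
      simp only [id]; omega
    · rw [← mul_assoc (2 ^ T.card)]
      exact Nat.mul_le_mul_right _ hI
  · intro Z hZV hZk
    set T' := Z ∩ T with hT'
    set Z' := Z \ T with hZ'
    have hcard : T'.card + Z'.card = Z.card := Finset.card_inter_add_card_sdiff Z T
    have hun : T' ∪ Z' = Z := by
      ext x; simp only [hT', hZ', Finset.mem_union, Finset.mem_inter, Finset.mem_sdiff]; tauto
    by_contra hcon
    push Not at hcon
    have hmem : Z' ∈ S T' Z'.card := by
      simp only [S, Finset.mem_filter, Finset.mem_univ, true_and]
      refine ⟨Finset.disjoint_sdiff, ?_⟩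
      rw [hun, hcard]; exact hcon
    have hbigZ : ∀ W ∈ Y T' Z'.card, Disjoint Z' W := by
      intro W hW
      refine (hZV.mono_left Finset.sdiff_subset).mono_right ?_
      intro x hx
      refine Finset.mem_biUnion.2 ⟨(T', Z'.card), ?_, Finset.mem_biUnion.2 ⟨W, hW, hx⟩⟩
      simp only [I, Finset.mem_filter, Finset.mem_product, Finset.mem_powerset, Finset.mem_range]
      exact ⟨⟨Finset.inter_subset_right, by omega⟩, by omega⟩
    have hZ0 : Z' = ∅ := by
      rcases hY2 T' Z'.card Z' hmem with h | ⟨W, hW, h⟩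
      · exact Finset.disjoint_self_iff_empty _ |>.1 (hbigZ _ h)
      · exact absurd (hbigZ W hW) h
    rw [hZ0, Finset.union_empty] at hun
    have h2 := hD T' Finset.inter_subset_right (by omega)
    rw [hun] at h2
    have : 0 ≤ δ * ε ^ Z.card * Fintype.card K := by positivity
    linarith

end Comb2

section Norm
variable {K : Type*} [AddCommGroup K] [Fintype K] [DecidableEq K]

/-- The norm game: `good A k P` says that the pair `P` survives `k` more moves. -/
def good (A : Finset K) : ℕ → (Bool → Set K) → Prop
  | 0, P => ∀ b, (P b).Nonempty
  | k + 1, P => good A k P ∧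
      (∀ z : K, ∃ b, good A k (Function.update P b (P b ∩ {x | x + z ∈ A}))) ∧
      (∀ (b : Bool) (B F : Finset K), (B.card : ℝ) ≤ (1 / 2) ^ (k + 4) * Fintype.card K →
        2 * F.card ≤ Fintype.card K →
        ∃ y ∉ F, good A k (Function.update P b (P b \ {x | ∃ u ∈ B, x = u + y})))

/-- Growth function for the forbidden sets. -/
def Rf (k w : ℕ) : ℕ → ℕ
  | 0 => 0
  | i + 1 => Rf k w i + 2 ^ (Rf k w i + 2 * k) * ((k + 1) * (w * k))

lemma Rf_mono (k w : ℕ) : Monotone (Rf k w) :=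
  monotone_nat_of_le_succ fun i => by simp [Rf]

/-- The invariant. -/
def GInv (A : Finset K) (k w : ℕ) (ε : ℝ) (j : ℕ) (P : Bool → Set K) : Prop :=
  ∃ Z V D : Bool → Finset K, (∀ b, ∀ x ∈ sh A (Z b), x ∉ D b → x ∈ P b) ∧
    (∀ b, Disjoint (V b) (V (!b))) ∧ (∀ b, Disjoint (Z b) (V b)) ∧
    (∀ b, (Z b).card + j ≤ k) ∧ (V true).card + (V false).card ≤ Rf k w (k - j) ∧
    ∀ b W, Disjoint W (V b) → W.card ≤ k →
      ((D b ∩ sh A W).card : ℝ) ≤ (1 / 2) ^ (j + 1) * ε ^ W.card * Fintype.card K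

lemma good_of_inv {A : Finset K} {k w : ℕ} {ε τ : ℝ} (hε0 : 0 < ε) (hε1 : ε ≤ 1)
    (hA : QRand A (3 * k) ε τ) (hτ : 8 * τ ≤ ((1 / 2) ^ (k + 4)) ^ 2 * ε ^ (6 * k))
    (hτ2 : 2 * τ < ε ^ k)
    (hw : 2 ≤ (w : ℝ) * (((1 / 2) ^ (k + 4)) ^ 2 * ε ^ (6 * k)))
    (hq : 2 * (2 ^ (Rf k w k + 2 * k) * (w * (k ^ 2 + 1))) < Fintype.card K) :
    ∀ j P, GInv A k w ε j P → good A j P := by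
  have hq0 : (0:ℝ) < Fintype.card K := by
    have : 0 < Fintype.card K := Fintype.card_pos
    exact_mod_cast this
  intro j
  induction j with
  | zero =>
    rintro P ⟨Z, V, D, hP, -, hZV, hZk, -, hD⟩ b
    have h1 := hD b (Z b) (hZV b) (hZk b)
    have h2 := (abs_le.1 (hA (Z b) (by have := hZk b; omega))).1
    have h3 : ε ^ k ≤ ε ^ (Z b).card := pow_le_pow_of_le_one hε0.le hε1 (hZk b)
    have h4 : ((D b ∩ sh A (Z b)).card : ℝ) < (sh A (Z b)).card := by
      refine h1.trans_lt ?_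
      have : τ * Fintype.card K < 1 / 2 * ε ^ (Z b).card * Fintype.card K := by
        apply mul_lt_mul_of_pos_right _ hq0; linarith
      simp only [zero_add, pow_one]
      linarith
    have h5 : (D b ∩ sh A (Z b)).card < (sh A (Z b)).card := by exact_mod_cast h4
    obtain ⟨x, hx, hx'⟩ := Finset.exists_mem_notMem_of_card_lt_card h5
    exact ⟨x, hP b x hx fun h => hx' (Finset.mem_inter.2 ⟨h, hx⟩)⟩
  | succ j ih =>
    rintro P ⟨Z, V, D, hP, hVV, hZV, hZk, hVR, hD⟩
    have hjk : j + 1 ≤ k := by have := hZk true; omega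
    have hR1 : Rf k w (k - j) = Rf k w (k - (j + 1)) +
        2 ^ (Rf k w (k - (j + 1)) + 2 * k) * ((k + 1) * (w * k)) := by
      rw [show k - j = (k - (j + 1)) + 1 by omega, Rf]
    have hDmono : ∀ b W, Disjoint W (V b) → W.card ≤ k →
      ((D b ∩ sh A W).card : ℝ) ≤ (1 / 2) ^ (j + 1) * ε ^ W.card * Fintype.card K := by
      intro b W h1 h2
      refine (hD b W h1 h2).trans ?_
      have : ((1:ℝ) / 2) ^ (j + 1 + 1) ≤ (1 / 2) ^ (j + 1) :=
        pow_le_pow_of_le_one (by norm_num) (by norm_num) (by omega)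
      gcongr
    refine ⟨ih P ⟨Z, V, D, hP, hVV, hZV, fun b => by have := hZk b; omega, by omega, hDmono⟩,
      ?_, ?_⟩
    · intro z
      have hb : ∃ b, z ∉ V b := by
        by_contra hcon
        push Not at hcon
        exact Finset.disjoint_left.1 (hVV true) (hcon true) (hcon _)
      obtain ⟨b, hb⟩ := hb
      refine ⟨b, ih _ ⟨Function.update Z b (insert z (Z b)), V, D, ?_, hVV, ?_, ?_, by omega,
        hDmono⟩⟩
      · intro c x hx hxD
        by_cases hcb : c = b
        · subst hcb
          simp only [Function.update_self] at hx ⊢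
          rw [mem_sh] at hx
          exact ⟨hP c x (mem_sh.2 fun u hu => hx u (Finset.mem_insert_of_mem hu)) hxD,
            hx z (Finset.mem_insert_self _ _)⟩
        · simp only [Function.update_of_ne hcb] at hx ⊢
          exact hP c x hx hxD
      · intro c
        by_cases hcb : c = b
        · subst hcb
          simp only [Function.update_self, Finset.disjoint_insert_left]
          exact ⟨hb, hZV c⟩
        · simp only [Function.update_of_ne hcb]; exact hZV c
      · intro c
        have := hZk c
        by_cases hcb : c = b
        · subst hcb
          simp only [Function.update_self]
          have := Finset.card_insert_le z (Z c)
          omega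
        · simp only [Function.update_of_ne hcb]; omega
    · intro b B F hB hF
      set δ : ℝ := (1 / 2) ^ (j + 4) with hδ
      have hδ0 : 0 < δ := by positivity
      have hδk : ((1:ℝ) / 2) ^ (k + 4) ≤ δ :=
        pow_le_pow_of_le_one (by norm_num) (by norm_num) (by omega)
      have hsq : (((1:ℝ) / 2) ^ (k + 4)) ^ 2 * ε ^ (6 * k) ≤ δ ^ 2 * ε ^ (6 * k) := by gcongr
      have hτ' : 8 * τ ≤ δ ^ 2 * ε ^ (6 * k) := hτ.trans hsq
      have hw' : 2 ≤ (w : ℝ) * (δ ^ 2 * ε ^ (6 * k)) := hw.trans (by gcongr)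
      have hsq2 : δ ^ 2 * ε ^ (6 * k) ≤ (2 * δ) ^ 2 * ε ^ (6 * k) := by
        gcongr; linarith
      have hτ'' : 8 * τ ≤ (2 * δ) ^ 2 * ε ^ (6 * k) := hτ'.trans hsq2
      have hw'' : 2 ≤ (w : ℝ) * ((2 * δ) ^ 2 * ε ^ (6 * k)) := hw'.trans (by gcongr)
      set T := (V true ∪ V false) ∪ (Z true ∪ Z false) with hT
      have hTc : T.card ≤ Rf k w (k - (j + 1)) + 2 * k := by
        have a1 := Finset.card_union_le (V true ∪ V false) (Z true ∪ Z false)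
        have a2 := Finset.card_union_le (V true) (V false)
        have a3 := Finset.card_union_le (Z true) (Z false)
        have a4 := hZk true
        have a5 := hZk false
        rw [← hT] at a1
        omega
      have hVT : ∀ c, V c ⊆ T := by
        intro c x hx
        simp only [hT, Finset.mem_union]
        cases c <;> simp [hx]
      have hZT : ∀ c, Z c ⊆ T := by
        intro c x hx
        simp only [hT, Finset.mem_union]
        cases c <;> simp [hx]
      let G := (T.powerset.filter fun T' => T'.card ≤ k).biUnion fun T' =>
        Finset.univ.filter fun y : K => 2 * δ * ε ^ T'.card * Fintype.card K <
          ((B.image (· + y) ∩ sh A T').card : ℝ)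
      have hG : G.card ≤ 2 ^ (Rf k w k + 2 * k) * (w * (k ^ 2 + 1)) := by
        refine (Finset.card_biUnion_le_card_mul _ _ (w * (k ^ 2 + 1)) ?_).trans ?_
        · intro T' hT'
          exact bad_translates hε0 hε1 hδ0 hA hτ' hw' T' B (Finset.mem_filter.1 hT').2 hB
        · refine Nat.mul_le_mul_right _ ((Finset.card_filter_le _ _).trans ?_)
          rw [Finset.card_powerset]
          refine Nat.pow_le_pow_right (by norm_num) (hTc.trans ?_)
          have := Rf_mono k w (show k - (j + 1) ≤ k by omega)
          omega
      have hy : ∃ y, y ∉ F ∪ G := by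
        by_contra hcon
        push Not at hcon
        have h1 : Finset.univ ⊆ F ∪ G := fun y _ => hcon y
        have h2 := Finset.card_le_card h1
        have h3 := Finset.card_union_le F G
        rw [Finset.card_univ] at h2
        omega
      obtain ⟨y, hy⟩ := hy
      rw [Finset.mem_union, not_or] at hy
      refine ⟨y, hy.1, ?_⟩
      obtain ⟨U, hUT, hUc, hU⟩ := core_sets hε0 hε1 (show 0 < 2 * δ by positivity) hA hτ'' hw'' T
        (B.image (· + y)) (by
          intro T' hT' hT'k
          by_contra hcon
          push Not at hcon
          apply hy.2
          exact Finset.mem_biUnion.2 ⟨T', by simp [hT', hT'k], by simpa using hcon⟩)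
      apply ih
      refine ⟨Z, Function.update V b (V b ∪ U), Function.update D b (D b ∪ B.image (· + y)),
        ?_, ?_, ?_, fun c => by have := hZk c; omega, ?_, ?_⟩
      · intro c x hx hxD
        by_cases hcb : c = b
        · subst hcb
          simp only [Function.update_self, Finset.mem_union, not_or] at hxD ⊢
          refine ⟨hP c x hx hxD.1, ?_⟩
          rintro ⟨u, hu, rfl⟩
          exact hxD.2 (Finset.mem_image.2 ⟨u, hu, rfl⟩)
        · simp only [Function.update_of_ne hcb] at hxD ⊢
          exact hP c x hx hxD
      · intro c
        by_cases hcb : c = b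
        · subst hcb
          rw [Function.update_self, Function.update_of_ne (by simp), Finset.disjoint_union_left]
          exact ⟨hVV c, hUT.mono_right (hVT _)⟩
        · have hcb' : (!c) = b := by
            cases c <;> cases b <;> simp_all
          rw [Function.update_of_ne hcb, hcb', Function.update_self, Finset.disjoint_union_right]
          refine ⟨hcb' ▸ hVV c, (hUT.mono_right (hVT _)).symm⟩
      · intro c
        by_cases hcb : c = b
        · subst hcb
          rw [Function.update_self, Finset.disjoint_union_right]
          exact ⟨hZV c, (hUT.mono_right (hZT c)).symm⟩
        · rw [Function.update_of_ne hcb]; exact hZV c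
      · have h1 := Finset.card_union_le (V b) U
        have h2 : U.card ≤ 2 ^ (Rf k w (k - (j + 1)) + 2 * k) * ((k + 1) * (w * k)) :=
          hUc.trans (Nat.mul_le_mul_right _ (Nat.pow_le_pow_right (by norm_num) hTc))
        rw [hR1]
        cases b
        · rw [Function.update_of_ne (by simp), Function.update_self]; omega
        · rw [Function.update_self, Function.update_of_ne (by simp)]; omega
      · intro c W hW hWk
        by_cases hcb : c = b
        · subst hcb
          rw [Function.update_self, Finset.disjoint_union_right] at hW
          rw [Function.update_self, Finset.union_inter_distrib_right]
          have h1 := hD c W hW.1 hWk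
          have h2 := hU W hW.2 hWk
          have h3 : (((D c ∩ sh A W) ∪ (B.image (· + y) ∩ sh A W)).card : ℝ) ≤
              ((D c ∩ sh A W).card : ℝ) + ((B.image (· + y) ∩ sh A W).card : ℝ) := by
            exact_mod_cast Finset.card_union_le _ _
          refine h3.trans ((add_le_add h1 h2).trans (le_of_eq ?_))
          rw [hδ, show j + 4 = j + 1 + 3 by ring, pow_succ _ (j + 1), pow_add _ (j + 1) 3]
          ring
        · rw [Function.update_of_ne hcb] at hW ⊢
          exact hDmono c W hW hWk

end Norm

theorem exists_good (k : ℕ) : ∃ (m : ℕ) (A : Finset (FK m)),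
    1 ≤ m ∧ (A.card : ℝ) ≤ (1 / 2) ^ k * 2 ^ m ∧ good A k (fun _ => Set.univ) := by
  set ε : ℝ := (1 / 2) ^ (k + 1) with hε
  have hε0 : 0 < ε := by positivity
  have hε1 : ε ≤ 1 := pow_le_one₀ (by norm_num) (by norm_num)
  set e : ℝ := ((1 / 2) ^ (k + 4)) ^ 2 * ε ^ (6 * k) with he
  have he0 : 0 < e := by positivity
  set τ : ℝ := min ε (min (ε ^ k / 4) (e / 8)) with hτ
  have hτ0 : 0 < τ := by positivity
  have hτ1 : τ ≤ ε := min_le_left _ _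
  have hτ2 : τ ≤ ε ^ k / 4 := (min_le_right _ _).trans (min_le_left _ _)
  have hτ3 : τ ≤ e / 8 := (min_le_right _ _).trans (min_le_right _ _)
  obtain ⟨w, hw⟩ := exists_nat_ge (2 / e)
  rw [div_le_iff₀ he0] at hw
  obtain ⟨m, hm, A, hA⟩ := exists_QR (3 * k + 1) ε τ hε0.le hε1 hτ0
    (2 * (2 ^ (Rf k w k + 2 * k) * (w * (k ^ 2 + 1))) + 2)
  have hcK : Fintype.card (FK m) = 2 ^ m := by simp [FK]
  have hεk : 0 < ε ^ k := by positivity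
  refine ⟨m, A, ?_, ?_, ?_⟩
  · by_contra h
    have : m = 0 := by omega
    subst this
    simp only [pow_zero] at hm
    omega
  · have h1 := hA {0} (by simp)
    have h2 : sh A {0} = A := by ext x; simp [mem_sh]
    rw [h2, Finset.card_singleton, pow_one] at h1
    have h3 := (abs_le.1 h1).2
    have h4 : τ * 2 ^ m ≤ ε * 2 ^ m := by gcongr
    have h5 : ((1:ℝ) / 2) ^ k = 2 * ε := by rw [hε, pow_succ]; ring
    rw [h5]; linarith
  · apply good_of_inv (w := w) hε0 hε1 (τ := τ) _ (by linarith) (by linarith) hw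
      (by rw [hcK]; omega)
    · refine ⟨fun _ => ∅, fun _ => ∅, fun _ => ∅, ?_, ?_, ?_, ?_, ?_, ?_⟩ <;> simp
      intro W _
      positivity
    · intro Z hZ
      rw [hcK]; push_cast
      exact hA Z (by omega)

section Meas

instance μ_leftInv : μ.IsAddLeftInvariant := by unfold μ; infer_instance

lemma μ_inv (g : Cantor) (E : Set Cantor) : μ {x | x + g ∈ E} = μ E := by
  exact measure_preimage_add_right μ g E

instance μ_prob : IsProbabilityMeasure μ := ⟨by
  have := Measure.addHaarMeasure_self (K₀ := (⟨⟨Set.univ, isCompact_univ⟩, by simp⟩ : TopologicalSpace.PositiveCompacts Cantor))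
  exact this⟩

instance μ_openPos : μ.IsOpenPosMeasure := by unfold μ; infer_instance
instance μ_regular : μ.Regular := by unfold μ; infer_instance

lemma c_add_self (x : Cantor) : x + x = 0 := by
  funext i; exact CharTwo.add_self_eq_zero _

lemma f_add_self {m : ℕ} (x : FK m) : x + x = 0 := by
  funext i; exact CharTwo.add_self_eq_zero _

open Classical in
lemma avg {ι : Type*} [Fintype ι] (g : ι → Cantor) {E : Set Cantor} (hE : MeasurableSet E) :
    ∫⁻ x, ((Finset.univ.filter fun t => x + g t ∈ E).card : ℝ≥0∞) ∂μ = Fintype.card ι * μ E := by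
  have h1 : ∀ x : Cantor, ((Finset.univ.filter fun t => x + g t ∈ E).card : ℝ≥0∞) =
      ∑ t, ({x | x + g t ∈ E} : Set Cantor).indicator 1 x := by
    intro x
    rw [Finset.card_filter]
    push_cast
    refine Finset.sum_congr rfl fun t _ => ?_
    simp [Set.indicator_apply]
  have hm : ∀ t, MeasurableSet {x | x + g t ∈ E} := fun t =>
    (measurable_add_const (g t)) hE
  simp_rw [h1]
  rw [lintegral_finsetSum _ fun t _ => measurable_one.indicator (hm t)]
  simp_rw [lintegral_indicator_one (hm _), μ_inv]
  simp

open Classical in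
lemma markov {ι : Type*} [Fintype ι] [Nonempty ι] (g : ι → Cantor) {E : Set Cantor}
    (hE : MeasurableSet E) {θ κ : ℝ} (hθ : 0 < θ) (h : μ E ≤ ENNReal.ofReal (θ * κ)) :
    μ {x | θ * Fintype.card ι ≤ ((Finset.univ.filter fun t => x + g t ∈ E).card : ℝ)} ≤
      ENNReal.ofReal κ := by
  have hc : (0:ℝ) < Fintype.card ι := by exact_mod_cast Fintype.card_pos
  have hmeas : Measurable fun x : Cantor =>
      ((Finset.univ.filter fun t => x + g t ∈ E).card : ℝ≥0∞) := by
    have h1 : (fun x : Cantor => ((Finset.univ.filter fun t => x + g t ∈ E).card : ℝ≥0∞)) =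
      fun x => ∑ t, ({x | x + g t ∈ E} : Set Cantor).indicator 1 x := by
      funext x
      rw [Finset.card_filter]
      push_cast
      refine Finset.sum_congr rfl fun t _ => ?_
      simp [Set.indicator_apply]
    rw [h1]
    exact Finset.measurable_sum _ fun t _ =>
      measurable_one.indicator ((measurable_add_const (g t)) hE)
  have h2 := mul_meas_ge_le_lintegral (μ := μ) hmeas (ENNReal.ofReal (θ * Fintype.card ι))
  rw [avg g hE] at h2
  have h3 : {x | θ * Fintype.card ι ≤ ((Finset.univ.filter fun t => x + g t ∈ E).card : ℝ)} =
      {x | ENNReal.ofReal (θ * Fintype.card ι) ≤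
        ((Finset.univ.filter fun t => x + g t ∈ E).card : ℝ≥0∞)} := by
    ext x
    simp only [Set.mem_ofPred_eq]
    rw [← ENNReal.ofReal_natCast, ENNReal.ofReal_le_ofReal_iff (by positivity)]
  rw [h3]
  have h4 : (Fintype.card ι : ℝ≥0∞) * μ E ≤
      ENNReal.ofReal (θ * Fintype.card ι) * ENNReal.ofReal κ := by
    calc _ ≤ (Fintype.card ι : ℝ≥0∞) * ENNReal.ofReal (θ * κ) := by gcongr
      _ = _ := by
        rw [ENNReal.ofReal_mul hθ.le, ENNReal.ofReal_mul hθ.le, ENNReal.ofReal_natCast]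
        ring
  refine (ENNReal.mul_le_mul_iff_right ?_ ?_).1 (h2.trans h4)
  · simp only [ne_eq, ENNReal.ofReal_eq_zero, not_le]; positivity
  · exact ENNReal.ofReal_ne_top

/-- `E` depends only on the coordinates below `N`. -/
def Dep (N : ℕ) (E : Set Cantor) : Prop :=
  ∀ x y : Cantor, (∀ i < N, x i = y i) → x ∈ E → y ∈ E

lemma Dep.isOpen {N : ℕ} {E : Set Cantor} (h : Dep N E) : IsOpen E := by
  rw [isOpen_iff_forall_mem_open]
  intro x hx
  refine ⟨PiNat.cylinder x N, fun y hy => h x y (fun i hi => ?_) hx,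
    PiNat.isOpen_cylinder _ x N, PiNat.self_mem_cylinder x N⟩
  exact (hy i hi).symm

/-- Extension by zero. -/
def ext0 {M : ℕ} (v : FK M) : Cantor := fun j => if h : j < M then v ⟨j, h⟩ else 0

/-- Saturation over the first `M` coordinates. -/
def sat (M : ℕ) (E : Set Cantor) : Set Cantor := ⋃ v : FK M, {x | x + ext0 v ∈ E}

lemma subset_sat (M : ℕ) (E : Set Cantor) : E ⊆ sat M E := by
  intro x hx
  refine Set.mem_iUnion.2 ⟨0, ?_⟩
  have : ext0 (0 : FK M) = 0 := by funext j; simp [ext0]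
  simp only [Set.mem_ofPred_eq, this, add_zero]
  exact hx

lemma sat_dep {M N : ℕ} {E : Set Cantor} (hE : Dep N E) {x y : Cantor}
    (h : ∀ i, M ≤ i → i < N → x i = y i) (hx : x ∈ sat M E) : y ∈ sat M E := by
  obtain ⟨v, hv⟩ := Set.mem_iUnion.1 hx
  refine Set.mem_iUnion.2 ⟨fun i => v i + (x i - y i), hE _ _ (fun i hi => ?_) hv⟩
  simp only [Pi.add_apply, ext0]
  split_ifs with h1
  · ring
  · rw [h i (by omega) hi]

lemma sat_measurable {M N : ℕ} {E : Set Cantor} (hE : Dep N E) : MeasurableSet (sat M E) :=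
  MeasurableSet.iUnion fun v => (measurable_add_const (ext0 v)) hE.isOpen.measurableSet

lemma sat_measure (M : ℕ) (E : Set Cantor) : μ (sat M E) ≤ 2 ^ M * μ E := by
  refine (measure_iUnion_le _).trans ?_
  rw [tsum_fintype]
  simp_rw [μ_inv]
  simp [FK]

lemma null_code {G : Set Cantor} (hG : μ G = 0) : ∃ F : ℕ → Set Cantor, (∀ m, Dep m (F m)) ∧
    (∀ x ∈ G, ∀ N, ∃ m ≥ N, x ∈ F m) ∧
    ∀ η : ℝ≥0∞, 0 < η → ∃ N, ∀ N' ≥ N, μ (⋃ m ≥ N', F m) ≤ η := by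
  have hU : ∀ j : ℕ, ∃ U ⊇ G, IsOpen U ∧ μ U < (2⁻¹ : ℝ≥0∞) ^ j := fun j =>
    G.exists_isOpen_lt_of_lt _ (by rw [hG]; exact ENNReal.pow_pos (by simp) j)
  choose U hGU hUo hUm using hU
  let C : ℕ → ℕ → Set Cantor := fun j m => {x | PiNat.cylinder x m ⊆ U j ∧
    ∀ m' < m, ¬ PiNat.cylinder x m' ⊆ U j}
  have hcyl : ∀ (x y : Cantor) m, (∀ i < m, x i = y i) → ∀ m' ≤ m,
      PiNat.cylinder x m' = PiNat.cylinder y m' := by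
    intro x y m h m' hm'
    ext u
    simp only [PiNat.cylinder, Set.mem_ofPred_eq]
    refine forall_congr' fun i => forall_congr' fun hi => ?_
    rw [h i (by omega)]
  have hC : ∀ j m, Dep m (C j m) := by
    intro j m x y h hx
    refine ⟨?_, fun m' hm' => ?_⟩
    · rw [← hcyl x y m h m le_rfl]; exact hx.1
    · rw [← hcyl x y m h m' hm'.le]; exact hx.2 m' hm'
  refine ⟨fun m => ⋃ j, C j m, ?_, ?_, ?_⟩
  · intro m x y h hx
    obtain ⟨j, hj⟩ := Set.mem_iUnion.1 hx
    exact Set.mem_iUnion.2 ⟨j, hC j m x y h hj⟩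
  · intro x hx N
    by_contra hcon
    push Not at hcon
    have h1 : ∀ j, PiNat.cylinder x N ⊆ U j := by
      intro j
      have hex : ∃ m, PiNat.cylinder x m ⊆ U j := by
        have := (PiNat.isTopologicalBasis_cylinders (fun _ : ℕ => ZMod 2)).mem_nhds_iff.1
          ((hUo j).mem_nhds (hGU j hx))
        obtain ⟨t, ⟨y, n, rfl⟩, hxt, ht⟩ := this
        exact ⟨n, by rwa [PiNat.mem_cylinder_iff_eq.1 hxt]⟩
      classical
      have hm := Nat.find_spec hex
      have hlt : Nat.find hex < N := by
        by_contra hge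
        exact hcon (Nat.find hex) (by omega)
          (Set.mem_iUnion.2 ⟨j, hm, fun m' hm' => Nat.find_min hex hm'⟩)
      exact (PiNat.cylinder_anti x hlt.le).trans hm
    have h2 : 0 < μ (PiNat.cylinder x N) := (PiNat.isOpen_cylinder _ x N).measure_pos μ
      ⟨x, PiNat.self_mem_cylinder x N⟩
    have h3 : Filter.Tendsto (fun j : ℕ => (2⁻¹ : ℝ≥0∞) ^ j) Filter.atTop (nhds 0) :=
      ENNReal.tendsto_pow_atTop_nhds_zero_of_lt_one (by simp)
    obtain ⟨j, hj⟩ := (h3.eventually_lt_const h2).exists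
    exact absurd ((measure_mono (h1 j)).trans_lt ((hUm j).trans hj)) (lt_irrefl _)
  · intro η hη
    have hsum : ∑' m, μ (⋃ j, C j m) ≠ ⊤ := by
      have h1 : ∑' m, μ (⋃ j, C j m) ≤ ∑' m, ∑' j, μ (C j m) :=
        ENNReal.tsum_le_tsum fun m => measure_iUnion_le _
      rw [ENNReal.tsum_comm] at h1
      have h2 : ∑' j, ∑' m, μ (C j m) ≤ ∑' j : ℕ, (2⁻¹ : ℝ≥0∞) ^ j := by
        refine ENNReal.tsum_le_tsum fun j => ?_
        rw [← measure_iUnion]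
        · refine (measure_mono ?_).trans (hUm j).le
          intro x hx
          obtain ⟨m, hm⟩ := Set.mem_iUnion.1 hx
          exact hm.1 (PiNat.self_mem_cylinder x m)
        · intro m m' hmm
          refine Set.disjoint_left.2 fun x hx hx' => ?_
          rcases lt_or_gt_of_ne hmm with h | h
          · exact hx'.2 m h hx.1
          · exact hx.2 m' h hx'.1
        · exact fun m => (hC j m).isOpen.measurableSet
      refine ne_top_of_le_ne_top ?_ (h1.trans h2)
      rw [ENNReal.tsum_geometric, ENNReal.one_sub_inv_two]
      simp
    have h3 := ENNReal.tendsto_sum_nat_add _ hsum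
    obtain ⟨N, hN⟩ := Filter.eventually_atTop.1 (h3.eventually_lt_const hη)
    refine ⟨N, fun N' hN' => ?_⟩
    have h4 : (⋃ m ≥ N', ⋃ j, C j m) ⊆ ⋃ m, ⋃ j, C j (m + N') := by
      intro x hx
      simp only [Set.mem_iUnion] at hx ⊢
      obtain ⟨m, hm, j, hj⟩ := hx
      exact ⟨m - N', j, by rwa [Nat.sub_add_cancel hm]⟩
    exact (measure_mono h4).trans ((measure_iUnion_le _).trans (hN N' hN').le)

end Meas

section Blocks

/-- Length of the `n`-th block. -/
noncomputable def mm (n : ℕ) : ℕ := (exists_good n).choose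

/-- The small set in the `n`-th block. -/
noncomputable def AA (n : ℕ) : Finset (FK (mm n)) := (exists_good n).choose_spec.choose

lemma mm_pos (n : ℕ) : 1 ≤ mm n := (exists_good n).choose_spec.choose_spec.1
lemma AA_card (n : ℕ) : ((AA n).card : ℝ) ≤ (1 / 2) ^ n * 2 ^ mm n :=
  (exists_good n).choose_spec.choose_spec.2.1
lemma AA_good (n : ℕ) : good (AA n) n (fun _ => Set.univ) :=
  (exists_good n).choose_spec.choose_spec.2.2

/-- Start of the `n`-th block. -/
noncomputable def aa (n : ℕ) : ℕ := ∑ i ∈ Finset.range n, mm i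

lemma aa_succ (n : ℕ) : aa (n + 1) = aa n + mm n := Finset.sum_range_succ _ _

lemma aa_strictMono : StrictMono aa := strictMono_nat_of_lt_succ fun n => by
  have := mm_pos n; rw [aa_succ]; omega

lemma le_aa (n : ℕ) : n ≤ aa n := aa_strictMono.le_apply

/-- The `n`-th block of `x`. -/
noncomputable def bl (n : ℕ) (x : Cantor) : FK (mm n) := fun i => x (aa n + i)

/-- Embedding of the `n`-th block. -/
noncomputable def emb (n : ℕ) (t : FK (mm n)) : Cantor :=
  fun j => if h : aa n ≤ j ∧ j < aa n + mm n then t ⟨j - aa n, by omega⟩ else 0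

lemma bl_add (n : ℕ) (x y : Cantor) : bl n (x + y) = bl n x + bl n y := rfl

lemma bl_emb (n : ℕ) (t : FK (mm n)) : bl n (emb n t) = t := by
  funext i
  simp only [bl, emb]
  rw [dif_pos ⟨by omega, by omega⟩]
  congr 1
  ext; simp

lemma bl_emb_ne {n n' : ℕ} (h : n ≠ n') (t : FK (mm n')) : bl n (emb n' t) = 0 := by
  funext i
  simp only [bl, emb]
  rw [dif_neg]
  · rfl
  · rintro ⟨h1, h2⟩
    have := i.2
    rcases lt_or_gt_of_ne h with h3 | h3
    · have := aa_strictMono.monotone (show n + 1 ≤ n' from h3)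
      rw [aa_succ] at this; omega
    · have := aa_strictMono.monotone (show n' + 1 ≤ n from h3)
      rw [aa_succ] at this; omega

lemma emb_add (n : ℕ) (s t : FK (mm n)) : emb n (s + t) = emb n s + emb n t := by
  funext j
  simp only [emb, Pi.add_apply]
  split_ifs <;> simp

lemma exists_block (i : ℕ) : ∃ n, aa n ≤ i ∧ i < aa (n + 1) := by
  classical
  have hex : ∃ n, i < aa (n + 1) := ⟨i, by have := le_aa (i + 1); omega⟩
  refine ⟨Nat.find hex, ?_, Nat.find_spec hex⟩
  by_contra h
  push Not at h
  rcases hk : Nat.find hex with _ | k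
  · rw [hk] at h; simp [aa] at h
  · rw [hk] at h
    exact Nat.find_min hex (m := k) (by omega) h

lemma agree_of_blocks {N N' : ℕ} {x y : Cantor}
    (h : ∀ n, N ≤ n → n < N' → bl n x = bl n y) (i : ℕ) (h1 : aa N ≤ i) (h2 : i < aa N') :
    x i = y i := by
  obtain ⟨n, hn1, hn2⟩ := exists_block i
  have hN : N ≤ n := by
    have := aa_strictMono.lt_iff_lt.1 (h1.trans_lt hn2); omega
  have hN' : n < N' := aa_strictMono.lt_iff_lt.1 (hn1.trans_lt h2)
  rw [aa_succ] at hn2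
  have := congrFun (h n hN hN') ⟨i - aa n, by omega⟩
  simp only [bl] at this
  rwa [Nat.add_sub_cancel' hn1] at this

lemma exists_glue (t : ∀ n, FK (mm n)) : ∃ x : Cantor, ∀ n, bl n x = t n := by
  refine ⟨fun i => ∑ n ∈ Finset.range (i + 1), emb n (t n) i, fun n => ?_⟩
  funext j
  simp only [bl]
  rw [Finset.sum_eq_single n]
  · exact congrFun (bl_emb n (t n)) j
  · intro n' _ h
    exact congrFun (bl_emb_ne h.symm (t n')) j
  · intro h
    exfalso; apply h
    have := le_aa n
    simp only [Finset.mem_range]; omega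

/-- The null set. -/
def HH : Set Cantor := {x | ∃ᶠ n in Filter.atTop, bl n x ∈ AA n}

lemma measurable_bl (n : ℕ) : Measurable (bl n) :=
  measurable_pi_lambda _ fun _ => measurable_pi_apply _

lemma HH_null : μ HH = 0 := by
  classical
  have hb : ∀ n, μ {x | bl n x ∈ AA n} ≤ (2⁻¹ : ℝ≥0∞) ^ n := by
    intro n
    have hm : MeasurableSet {x | bl n x ∈ AA n} :=
      measurable_bl n (AA n).finite_toSet.measurableSet
    have h1 := avg (emb n) hm
    have h2 : ∀ x : Cantor, (Finset.univ.filter fun t => x + emb n t ∈ {x | bl n x ∈ AA n}).card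
        = (AA n).card := by
      intro x
      refine Finset.card_bij (fun t _ => bl n x + t) ?_ ?_ ?_
      · intro t ht
        simpa [bl_add, bl_emb] using ht
      · intro t _ t' _ h
        exact add_left_cancel h
      · intro u hu
        refine ⟨u - bl n x, ?_, by abel⟩
        simpa [bl_add, bl_emb] using hu
    replace h1 : ∫⁻ _x : Cantor, ((AA n).card : ℝ≥0∞) ∂μ =
        Fintype.card (FK (mm n)) * μ {x | bl n x ∈ AA n} := by
      rw [← h1]
      refine lintegral_congr fun x => ?_
      rw [← h2 x]
      congr
    rw [lintegral_const, measure_univ, mul_one] at h1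
    have hc : Fintype.card (FK (mm n)) = 2 ^ mm n := by simp [FK]
    rw [hc] at h1
    have h3 : ((AA n).card : ℝ≥0∞) ≤ (2 ^ mm n : ℕ) * (2⁻¹ : ℝ≥0∞) ^ n := by
      have := AA_card n
      rw [← ENNReal.ofReal_natCast, ← ENNReal.ofReal_natCast, ← ENNReal.ofReal_ofNat 2,
        ← ENNReal.ofReal_inv_of_pos (by norm_num), ← ENNReal.ofReal_pow (by norm_num),
        ← ENNReal.ofReal_mul (by positivity)]
      apply ENNReal.ofReal_le_ofReal
      push_cast
      rw [one_div] at this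
      linarith
    rw [h1] at h3
    refine (ENNReal.mul_le_mul_iff_right ?_ ?_).1 h3
    · simp
    · exact ENNReal.natCast_ne_top _
  apply measure_setOfPred_frequently_eq_zero
  refine ne_top_of_le_ne_top ?_ (ENNReal.tsum_le_tsum hb)
  rw [ENNReal.tsum_geometric, ENNReal.one_sub_inv_two]
  simp

end Blocks

section Conds
open Filter

/-- Conditions. -/
structure Cond where
  P : ∀ n, Bool → Set (FK (mm n))
  ne : ∀ n b, (P n b).Nonempty
  gd : ∀ j, ∃ᶠ n in atTop, good (AA n) j (P n)

/-- `Cle p q`: `p` is almost everywhere smaller than `q`. -/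
def Cle (p q : Cond) : Prop := ∀ᶠ n in atTop, ∀ b, p.P n b ⊆ q.P n b

/-- The branches of one side of a condition. -/
def br (p : Cond) (b : Bool) : Set Cantor := {x | ∀ᶠ n in atTop, bl n x ∈ p.P n b}

lemma Cle.refl (p : Cond) : Cle p p := Eventually.of_forall fun _ _ => subset_rfl

lemma Cle.trans {p q r : Cond} (h : Cle p q) (h' : Cle q r) : Cle p r := by
  filter_upwards [h, h'] with n h1 h2 b
  exact (h1 b).trans (h2 b)

lemma br_mono {p q : Cond} (h : Cle p q) (b : Bool) : br p b ⊆ br q b := by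
  intro x hx
  have hx' : ∀ᶠ n in atTop, bl n x ∈ p.P n b := hx
  show ∀ᶠ n in atTop, bl n x ∈ q.P n b
  filter_upwards [h, hx'] with n h1 h2
  exact h1 b h2

lemma good_anti {K : Type*} [AddCommGroup K] [Fintype K] [DecidableEq K] {A : Finset K}
    {P : Bool → Set K} {j k : ℕ} (hjk : j ≤ k) (h : good A k P) : good A j P := by
  induction k with
  | zero =>
    have : j = 0 := by omega
    subst this; exact h
  | succ k ih =>
    rcases Nat.lt_or_ge k j with h1 | h1
    · have : j = k + 1 := by omega
      subst this; exact h
    · exact ih h1 h.1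

/-- The trivial condition. -/
def topC : Cond where
  P := fun _ _ => Set.univ
  ne := fun _ _ => Set.univ_nonempty
  gd := fun j => by
    apply Eventually.frequently
    filter_upwards [eventually_ge_atTop j] with n hn
    exact good_anti hn (AA_good n)

lemma exists_seq (Q : ℕ → ℕ → ℕ → Prop) (h : ∀ i a, ∃ a' > a, Q i a a') :
    ∃ f : ℕ → ℕ, StrictMono f ∧ f 0 = 0 ∧ ∀ i, Q i (f i) (f (i + 1)) := by
  choose g hg1 hg2 using h
  let f : ℕ → ℕ := fun n => Nat.rec 0 (fun i a => g i a) n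
  have hf : ∀ i, f (i + 1) = g i (f i) := fun i => rfl
  refine ⟨f, strictMono_nat_of_lt_succ fun i => ?_, rfl, fun i => ?_⟩
  · rw [hf]; exact hg1 _ _
  · rw [hf]; exact hg2 _ _

lemma exists_interval {f : ℕ → ℕ} (hf : StrictMono f) {i0 m : ℕ} (h : f i0 ≤ m) :
    ∃ i ≥ i0, f i ≤ m ∧ m < f (i + 1) := by
  classical
  have hex : ∃ i, m < f (i + 1) := ⟨m, by have := hf.le_apply (x := m + 1); omega⟩
  have hs := Nat.find_spec hex
  have h1 : i0 ≤ Nat.find hex := by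
    have := hf.lt_iff_lt.1 (h.trans_lt hs); omega
  refine ⟨Nat.find hex, h1, ?_, hs⟩
  rcases hk : Nat.find hex with _ | k
  · have : i0 = 0 := by omega
    rw [← this]; exact h
  · by_contra hcon
    exact Nat.find_min hex (m := k) (by omega) (by omega)

lemma lower_bound_dec (r : ℕ → Cond) (hr : ∀ i, Cle (r (i + 1)) (r i)) :
    ∃ p, ∀ i, Cle p (r i) := by
  have hle : ∀ i d, Cle (r (i + d)) (r i) := by
    intro i d
    induction d with
    | zero => exact Cle.refl _
    | succ d ih => exact (hr _).trans ih
  obtain ⟨N, hNm, hN0, hN⟩ := exists_seq (fun j a a' =>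
      (∃ n, a ≤ n ∧ n < a' ∧ good (AA n) j ((r j).P n)) ∧
      ∀ n ≥ a', ∀ i ≤ j + 1, ∀ b, (r (j + 1)).P n b ⊆ (r i).P n b) (by
    intro j a
    obtain ⟨n, hn1, hn2⟩ := ((frequently_atTop.1 ((r j).gd j)) a)
    have h2 : ∀ᶠ n in atTop, ∀ i ∈ Finset.range (j + 2), ∀ b, (r (j + 1)).P n b ⊆ (r i).P n b := by
      rw [Filter.eventually_all_finset]
      intro i hi
      have := hle i (j + 1 - i)
      rwa [show i + (j + 1 - i) = j + 1 by have := Finset.mem_range.1 hi; omega] at this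
    obtain ⟨m, hm⟩ := eventually_atTop.1 h2
    refine ⟨max (n + 1) m, by omega, ⟨n, hn1, by omega, hn2⟩, ?_⟩
    intro n' hn' i hi
    exact hm n' (by omega) i (Finset.mem_range.2 (by omega)))
  have hJ : ∀ n, ∃ j, N j ≤ n ∧ n < N (j + 1) := fun n => by
    obtain ⟨i, -, h⟩ := exists_interval hNm (i0 := 0) (m := n) (by omega)
    exact ⟨i, h⟩
  choose J hJ1 hJ2 using hJ
  have hsub : ∀ j n, N j ≤ n → ∀ i ≤ j, ∀ b, (r j).P n b ⊆ (r i).P n b := by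
    intro j n hn i hi b
    rcases j with _ | j
    · have : i = 0 := by omega
      subst this; exact subset_rfl
    · exact (hN j).2 n hn i hi b
  refine ⟨⟨fun n => (r (J n)).P n, fun n => (r (J n)).ne n, ?_⟩, ?_⟩
  · intro j
    rw [frequently_atTop]
    intro M
    obtain ⟨⟨n, h1, h2, h3⟩, -⟩ := hN (max j M)
    have h4 := hNm.le_apply (x := max j M)
    refine ⟨n, by omega, ?_⟩
    have h5 : J n = max j M := by
      have a1 := hNm.lt_iff_lt.1 ((hJ1 n).trans_lt h2)
      have a2 := hNm.lt_iff_lt.1 (h1.trans_lt (hJ2 n))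
      omega
    show good (AA n) j ((r (J n)).P n)
    rw [h5]
    exact good_anti (le_max_left _ _) h3
  · intro i
    refine eventually_atTop.2 ⟨N i, fun n hn b => ?_⟩
    have h1 : i ≤ J n := by
      have := hNm.lt_iff_lt.1 (hn.trans_lt (hJ2 n)); omega
    exact hsub (J n) n (hJ1 n) i h1 b

lemma lower_bound (s : ℕ → Cond) (hs : ∀ i j, Cle (s i) (s j) ∨ Cle (s j) (s i)) :
    ∃ p, ∀ i, Cle p (s i) := by
  classical
  let r : ℕ → Cond := fun n => Nat.rec (s 0)
    (fun i a => if Cle (s (i + 1)) a then s (i + 1) else a) n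
  have hr : ∀ i, r (i + 1) = if Cle (s (i + 1)) (r i) then s (i + 1) else r i := fun i => rfl
  have hrs : ∀ i, ∃ j, r i = s j := by
    intro i
    induction i with
    | zero => exact ⟨0, rfl⟩
    | succ i ih =>
      rw [hr]
      split_ifs
      · exact ⟨_, rfl⟩
      · exact ih
  have h1 : ∀ i, Cle (r (i + 1)) (r i) := by
    intro i
    rw [hr]
    split_ifs with h
    · exact h
    · exact Cle.refl _
  have h2 : ∀ i, Cle (r i) (s i) := by
    intro i
    rcases i with _ | i
    · exact Cle.refl _
    · rw [hr]
      split_ifs with h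
      · exact Cle.refl _
      · obtain ⟨j, hj⟩ := hrs i
        rw [hj] at h ⊢
        exact (hs _ _).resolve_left h
  obtain ⟨p, hp⟩ := lower_bound_dec r h1
  exact ⟨p, fun i => (hp i).trans (h2 i)⟩

lemma z_step (p : Cond) (z : Cantor) : ∃ (p' : Cond) (b : Bool) (x : Cantor),
    Cle p' p ∧ x ∈ br p' b ∧ x + z ∈ HH := by
  classical
  let U : Bool → ∀ n, Bool → Set (FK (mm n)) := fun b n =>
    Function.update (p.P n) b (p.P n b ∩ {x | x + bl n z ∈ AA n})
  have hUsub : ∀ b n c, U b n c ⊆ p.P n c := by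
    intro b n c
    by_cases h : c = b
    · subst h
      simp only [U, Function.update_self]; exact inter_subset_left
    · simp only [U, Function.update_of_ne h]; exact subset_rfl
  have hb : ∃ b, ∀ j, ∃ᶠ n in atTop, good (AA n) j (U b n) := by
    by_contra hcon
    push Not at hcon
    obtain ⟨j1, h1⟩ := hcon true
    obtain ⟨j2, h2⟩ := hcon false
    have h3 := p.gd (max j1 j2 + 1)
    obtain ⟨n, hn, hn1, hn2⟩ := (h3.and_eventually (h1.and h2)).exists
    obtain ⟨b, hb⟩ := hn.2.1 (bl n z)
    cases b
    · exact hn2 (good_anti (le_max_right _ _) hb)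
    · exact hn1 (good_anti (le_max_left _ _) hb)
  obtain ⟨b, hb⟩ := hb
  have hne : ∀ n c, (if good (AA n) 0 (U b n) then U b n else p.P n) c |>.Nonempty := by
    intro n c
    split_ifs with h
    · exact h c
    · exact p.ne n c
  let p' : Cond := ⟨fun n => if good (AA n) 0 (U b n) then U b n else p.P n, hne, fun j => by
    refine (hb j).mono fun n hn => ?_
    rw [if_pos (good_anti (Nat.zero_le _) hn)]
    exact hn⟩
  choose t ht using fun n => p'.ne n b
  obtain ⟨x, hx⟩ := exists_glue t
  have hxm : ∀ n, bl n x ∈ p'.P n b := fun n => by rw [hx]; exact ht n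
  refine ⟨p', b, x, ?_, Eventually.of_forall hxm, ?_⟩
  · refine Eventually.of_forall fun n c => ?_
    show (if good (AA n) 0 (U b n) then U b n else p.P n) c ⊆ _
    split_ifs
    · exact hUsub b n c
    · exact subset_rfl
  · refine (hb 0).mono fun n hn => ?_
    have h1 : bl n x ∈ (if good (AA n) 0 (U b n) then U b n else p.P n) b := hxm n
    rw [if_pos hn] at h1
    simp only [U, Function.update_self] at h1
    rw [bl_add]
    exact h1.2

end Conds

section GStep
open Filter

lemma exists_y0 (θ κ : ℕ → ℝ) (hθ : ∀ i, 0 < θ i)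
    (hκ : ∀ i, κ i = (1 / 2) ^ (i + 2) / (i + 1)) (N : ℕ → ℕ) (S : ℕ → Set Cantor)
    (hS : ∀ i, MeasurableSet (S i)) (hSμ : ∀ i, μ (S i) ≤ ENNReal.ofReal (θ i * κ i))
    (c : ℕ → Cantor) : ∃ y0 : Cantor, ∀ i, ∀ j ≤ i,
      (Nat.card {t : FK (mm (N i)) // y0 + (c j + emb (N i) t) ∈ S i} : ℝ) ≤
        θ i * Fintype.card (FK (mm (N i))) := by
  classical
  let Bd : ℕ → ℕ → Set Cantor := fun i j => {x | θ i * Fintype.card (FK (mm (N i))) ≤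
    ((Finset.univ.filter fun t : FK (mm (N i)) => x + (c j + emb (N i) t) ∈ S i).card : ℝ)}
  have hBd : ∀ i j, μ (Bd i j) ≤ ENNReal.ofReal (κ i) := by
    intro i j
    have := markov (fun t : FK (mm (N i)) => c j + emb (N i) t) (hS i) (hθ i) (hSμ i)
    convert this
  have h1 : μ (⋃ i, ⋃ j ∈ Finset.range (i + 1), Bd i j) < 1 := by
    calc _ ≤ ∑' i, μ (⋃ j ∈ Finset.range (i + 1), Bd i j) := measure_iUnion_le _
      _ ≤ ∑' i : ℕ, (2⁻¹ : ℝ≥0∞) ^ (i + 2) := by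
        refine ENNReal.tsum_le_tsum fun i => ?_
        refine (measure_biUnion_finset_le _ _).trans
          ((Finset.sum_le_sum fun j _ => hBd i j).trans (le_of_eq ?_))
        rw [Finset.sum_const, Finset.card_range, nsmul_eq_mul, hκ, ← ENNReal.ofReal_natCast,
          ← ENNReal.ofReal_mul (by positivity)]
        rw [← ENNReal.ofReal_ofNat 2, ← ENNReal.ofReal_inv_of_pos (by norm_num),
          ← ENNReal.ofReal_pow (by norm_num)]
        congr 1
        push_cast
        field_simp
      _ = 2⁻¹ := by
        simp_rw [pow_add]
        rw [ENNReal.tsum_mul_right, ENNReal.tsum_geometric, ENNReal.one_sub_inv_two, inv_inv, sq,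
          ← mul_assoc, ENNReal.mul_inv_cancel (by simp) (by simp), one_mul]
      _ < 1 := by simp
  have h2 : ∃ y0, y0 ∉ ⋃ i, ⋃ j ∈ Finset.range (i + 1), Bd i j := by
    by_contra hcon
    push Not at hcon
    rw [Set.eq_univ_of_forall hcon, measure_univ] at h1
    exact lt_irrefl _ h1
  obtain ⟨y0, hy0⟩ := h2
  refine ⟨y0, fun i j hj => ?_⟩
  by_contra hcon
  push Not at hcon
  apply hy0
  refine Set.mem_iUnion.2 ⟨i, Set.mem_iUnion₂.2 ⟨j, Finset.mem_range.2 (by omega), ?_⟩⟩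
  simp only [Bd, Set.mem_ofPred_eq]
  refine hcon.le.trans (le_of_eq ?_)
  rw [Nat.card_eq_fintype_card, Fintype.card_subtype]

set_option maxHeartbeats 1000000 in
lemma g_step_aux (p : Cond) (b : Bool) (G : Set Cantor) (hG : μ G = 0) (c : ℕ → Cantor)
    (hc0 : ∀ n, bl n (c 0) ∈ p.P n b) : ∃ (p' : Cond) (y : Cantor),
    Cle p' p ∧ (∀ x ∈ br p' b, x + y ∉ G) ∧ ∀ j, c j + y ∉ G := by
  classical
  obtain ⟨F, hFd, hFG, hFt⟩ := null_code hG
  let θ : ℕ → ℝ := fun i => (1 / 2) ^ (i + 4) / (i + 1) ^ 2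
  let κ : ℕ → ℝ := fun i => (1 / 2) ^ (i + 2) / (i + 1)
  have hθ : ∀ i, 0 < θ i := fun i => by simp only [θ]; positivity
  have hκ : ∀ i, 0 < κ i := fun i => by simp only [κ]; positivity
  obtain ⟨ns, hns, -, hQ⟩ := exists_seq (fun i a a' => good (AA a') (i + 1) (p.P a') ∧
      2 ^ (aa (a + 1)) * μ (⋃ m ≥ aa a', F m) ≤ ENNReal.ofReal (θ i * κ i)) (by
    intro i a
    have hpos : 0 < ENNReal.ofReal (θ i * κ i) / 2 ^ (aa (a + 1)) := by
      apply ENNReal.div_pos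
      · have := mul_pos (hθ i) (hκ i)
        simp only [ne_eq, ENNReal.ofReal_eq_zero, not_le]; exact this
      · exact ENNReal.pow_ne_top (by simp)
    obtain ⟨N, hN⟩ := hFt _ hpos
    obtain ⟨n, hn1, hn2⟩ := frequently_atTop.1 (p.gd (i + 1)) (max N (a + 1))
    refine ⟨n, by omega, hn2, ?_⟩
    have := hN (aa n) (by have := le_aa n; omega)
    refine (mul_le_mul_right this _).trans ?_
    exact ENNReal.mul_div_le)
  let E : ℕ → Set Cantor := fun i => ⋃ m, ⋃ (_ : aa (ns (i + 1)) ≤ m ∧ m < aa (ns (i + 2))), F m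
  have hEd : ∀ i, Dep (aa (ns (i + 2))) (E i) := by
    intro i x y h hx
    simp only [E, Set.mem_iUnion] at hx ⊢
    obtain ⟨m, hm, hx⟩ := hx
    exact ⟨m, hm, hFd m x y (fun k hk => h k (by omega)) hx⟩
  let S : ℕ → Set Cantor := fun i => sat (aa (ns i + 1)) (E i)
  have hSm : ∀ i, MeasurableSet (S i) := fun i => sat_measurable (hEd i)
  have hSμ : ∀ i, μ (S i) ≤ ENNReal.ofReal (θ i * κ i) := by
    intro i
    refine (sat_measure _ _).trans (le_trans ?_ (hQ i).2)
    gcongr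
    intro x hx
    simp only [E, Set.mem_iUnion] at hx ⊢
    obtain ⟨m, hm, hx⟩ := hx
    exact ⟨m, hm.1, hx⟩
  obtain ⟨y0, hy0⟩ := exists_y0 θ κ hθ (fun i => rfl) (fun i => ns (i + 1)) S hSm hSμ c
  let u : ℕ → ℕ → Cantor := fun n j => y0 + c j + emb n (bl n (y0 + c j))
  let B : ∀ n, ℕ → Finset (FK (mm n)) := fun n i => (Finset.range (i + 1)).biUnion fun j =>
    Finset.univ.filter fun t => u n j + emb n t ∈ S i
  have hclaim : ∀ w j i, j ≤ i → (∀ n, ns i < n → n < ns (i + 2) → n ≠ ns (i + 1) →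
      bl n w = bl n (y0 + c j)) → bl (ns (i + 1)) w ∉ B (ns (i + 1)) i → w ∉ E i := by
    intro w j i hj hw hwB hwE
    apply hwB
    refine Finset.mem_biUnion.2 ⟨j, Finset.mem_range.2 (by omega), ?_⟩
    refine Finset.mem_filter.2 ⟨Finset.mem_univ _, ?_⟩
    refine sat_dep (hEd i) (fun k hk1 hk2 => ?_) (subset_sat (aa (ns i + 1)) _ hwE)
    refine agree_of_blocks (N := ns i + 1) (N' := ns (i + 2)) (fun n hn1 hn2 => ?_) k hk1 hk2
    simp only [u]
    by_cases h : n = ns (i + 1)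
    · subst h
      rw [bl_add _ _ (emb _ (bl _ w)), bl_add _ _ (emb _ _), bl_emb, bl_emb, f_add_self, zero_add]
    · rw [bl_add _ _ (emb _ (bl _ w)), bl_add _ _ (emb _ _), bl_emb_ne h, bl_emb_ne h,
        add_zero, add_zero]
      exact hw n (by omega) hn2 h
  have hBc : ∀ i, ((B (ns (i + 1)) i).card : ℝ) ≤
      (i + 1) * (θ i * Fintype.card (FK (mm (ns (i + 1))))) := by
    intro i
    have h1 : ∀ j ∈ Finset.range (i + 1), ((Finset.univ.filter fun t =>
        u (ns (i + 1)) j + emb (ns (i + 1)) t ∈ S i).card : ℝ) ≤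
        θ i * Fintype.card (FK (mm (ns (i + 1)))) := by
      intro j hj
      refine le_trans (le_of_eq ?_) (hy0 i j (by have := Finset.mem_range.1 hj; omega))
      rw [Nat.card_eq_fintype_card, Fintype.card_subtype]
      congr 1
      refine Finset.card_bij (fun t _ => bl _ (y0 + c j) + t) ?_ ?_ ?_
      · intro t ht
        simp only [Finset.mem_filter, Finset.mem_univ, true_and, u] at ht ⊢
        rw [emb_add]
        convert ht using 1
        abel
      · intro t _ t' _ h
        exact add_left_cancel h
      · intro t ht
        refine ⟨t - bl _ (y0 + c j), ?_, by abel⟩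
        simp only [Finset.mem_filter, Finset.mem_univ, true_and, u] at ht ⊢
        rw [add_assoc, ← emb_add, add_sub_cancel, add_assoc]
        exact ht
    have h2 : ((B (ns (i + 1)) i).card : ℝ) ≤ ∑ j ∈ Finset.range (i + 1),
        ((Finset.univ.filter fun t =>
        u (ns (i + 1)) j + emb (ns (i + 1)) t ∈ S i).card : ℝ) := by
      exact_mod_cast Finset.card_biUnion_le
    refine h2.trans ((Finset.sum_le_sum h1).trans (le_of_eq ?_))
    rw [Finset.sum_const, Finset.card_range, nsmul_eq_mul]
    push_cast; ring
  -- choice at each level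
  have hlev : ∀ n, ∃ (t : FK (mm n)) (R : Bool → Set (FK (mm n))),
      (∀ d, (R d).Nonempty) ∧ (∀ d, R d ⊆ p.P n d) ∧
      (∀ i, n = ns (i + 1) → (∀ j ≤ i, bl n (c j) + t ∉ B n i) ∧ good (AA n) i R ∧
        ∀ x ∈ R b, x + t ∉ B n i) ∧
      ((∀ i, n ≠ ns (i + 1)) → t = bl n y0 ∧ R b = {bl n (c 0)}) := by
    intro n
    by_cases hn : ∃ i, n = ns (i + 1)
    · obtain ⟨i, rfl⟩ := hn
      set n := ns (i + 1) with hn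
      have hq0 : (0:ℝ) < Fintype.card (FK (mm n)) := by exact_mod_cast Fintype.card_pos
      have hi1 : (1:ℝ) ≤ i + 1 := by
        have : (0:ℝ) ≤ i := Nat.cast_nonneg _
        linarith
      have hB2 : ((i:ℝ) + 1) * (B n i).card ≤ (1 / 2) ^ (i + 4) * Fintype.card (FK (mm n)) := by
        calc ((i:ℝ) + 1) * (B n i).card ≤ (i + 1) * ((i + 1) * (θ i * Fintype.card (FK (mm n)))) := by
              gcongr; exact hBc i
          _ = _ := by simp only [θ]; field_simp
      have hB1 : ((B n i).card : ℝ) ≤ (1 / 2) ^ (i + 4) * Fintype.card (FK (mm n)) := by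
        have : (0:ℝ) ≤ (B n i).card := Nat.cast_nonneg _
        nlinarith
      let F' : Finset (FK (mm n)) := (Finset.range (i + 1)).biUnion fun j =>
        (B n i).image (bl n (c j) + ·)
      have hF' : 2 * F'.card ≤ Fintype.card (FK (mm n)) := by
        have h1 : F'.card ≤ (i + 1) * (B n i).card := by
          refine (Finset.card_biUnion_le_card_mul _ _ (B n i).card
            fun j _ => Finset.card_image_le).trans ?_
          rw [Finset.card_range]
        have h2 : (F'.card : ℝ) ≤ (i + 1) * (B n i).card := by exact_mod_cast h1
        have h3 : ((1:ℝ) / 2) ^ (i + 4) ≤ (1 / 2) ^ 1 :=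
          pow_le_pow_of_le_one (by norm_num) (by norm_num) (by omega)
        have h4 : (2:ℝ) * F'.card ≤ Fintype.card (FK (mm n)) := by nlinarith
        exact_mod_cast h4
      obtain ⟨t, ht, hgood⟩ := (hQ i).1.2.2 b (B n i) F' hB1 hF'
      refine ⟨t, _, good_anti (Nat.zero_le _) hgood, ?_, ?_, ?_⟩
      · intro d
        by_cases h : d = b
        · subst h
          rw [Function.update_self]; exact sdiff_subset
        · rw [Function.update_of_ne h]
      · intro i' hi'
        have : i = i' := by
          have := hns.injective hi'
          omega
        subst this
        refine ⟨fun j hj hcon => ht ?_, hgood, ?_⟩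
        · refine Finset.mem_biUnion.2 ⟨j, Finset.mem_range.2 (by omega),
            Finset.mem_image.2 ⟨_, hcon, ?_⟩⟩
          rw [← add_assoc, f_add_self, zero_add]
        · intro x hx hcon
          rw [Function.update_self] at hx
          apply hx.2
          refine ⟨x + t, hcon, ?_⟩
          rw [add_assoc, f_add_self, add_zero]
      · intro h
        exact absurd rfl (h i)
    · push Not at hn
      refine ⟨bl n y0, Function.update (p.P n) b {bl n (c 0)}, ?_, ?_, ?_, ?_⟩
      · intro d
        by_cases h : d = b
        · subst h
          rw [Function.update_self]; exact Set.singleton_nonempty _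
        · rw [Function.update_of_ne h]; exact p.ne n d
      · intro d
        by_cases h : d = b
        · subst h
          rw [Function.update_self]; exact Set.singleton_subset_iff.2 (hc0 n)
        · rw [Function.update_of_ne h]
      · intro i hi
        exact absurd hi (hn i)
      · intro _
        exact ⟨rfl, Function.update_self _ _ _⟩
  choose t R hRne hRsub hsp hnsp using hlev
  obtain ⟨y, hy⟩ := exists_glue t
  have hbetween : ∀ i n, ns i < n → n < ns (i + 2) → n ≠ ns (i + 1) → ∀ i', n ≠ ns (i' + 1) := by
    intro i n h1 h2 h3 i' h4
    subst h4
    have a1 := hns.lt_iff_lt.1 h1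
    have a2 := hns.lt_iff_lt.1 h2
    have : i' + 1 = i + 1 := by omega
    rw [this] at h3
    exact h3 rfl
  have hfinal : ∀ w i0, (∀ i ≥ i0, w ∉ E i) → w ∉ G := by
    intro w i0 hw hwG
    obtain ⟨m, hm, hwm⟩ := hFG w hwG (aa (ns (i0 + 1)))
    have hmono : StrictMono fun i => aa (ns (i + 1)) := fun i i' h =>
      aa_strictMono (hns (by omega))
    obtain ⟨i, hi, h1, h2⟩ := exists_interval hmono hm
    apply hw i hi
    simp only [E, Set.mem_iUnion]
    exact ⟨m, ⟨h1, h2⟩, hwm⟩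
  refine ⟨⟨R, hRne, ?_⟩, y, Eventually.of_forall hRsub, ?_, ?_⟩
  · intro j
    rw [frequently_atTop]
    intro M
    refine ⟨ns (max j M + 1), ?_, good_anti (le_max_left j M) (hsp _ (max j M) rfl).2.1⟩
    have := hns.le_apply (x := max j M + 1)
    omega
  · intro x hx
    obtain ⟨n1, hn1⟩ := eventually_atTop.1 (show ∀ᶠ n in atTop, bl n x ∈ R n b from hx)
    apply hfinal _ n1
    intro i hi
    have hle := hns.le_apply (x := i)
    refine hclaim _ 0 i (Nat.zero_le _) ?_ ?_
    · intro n h1 h2 h3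
      have h4 := hnsp n (hbetween i n h1 h2 h3)
      have h5 := hn1 n (by omega)
      rw [h4.2, Set.mem_singleton_iff] at h5
      rw [bl_add, bl_add, hy, h4.1, h5, add_comm]
    · have h5 := hn1 (ns (i + 1)) (by have := hns (show i < i + 1 by omega); omega)
      rw [bl_add, hy]
      exact (hsp _ i rfl).2.2 _ h5
  · intro j
    apply hfinal _ j
    intro i hi
    refine hclaim _ j i hi ?_ ?_
    · intro n h1 h2 h3
      have h4 := hnsp n (hbetween i n h1 h2 h3)
      rw [bl_add, bl_add, hy, h4.1, add_comm]
    · rw [bl_add, hy]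
      exact (hsp _ i rfl).1 j hi

lemma g_step (p : Cond) (b : Bool) (G : Set Cantor) (hG : μ G = 0) (X : Set Cantor)
    (hX : X.Countable) : ∃ (p' : Cond) (y : Cantor),
    Cle p' p ∧ (∀ x ∈ br p' b, x + y ∉ G) ∧ ∀ x ∈ X, x + y ∉ G := by
  choose t ht using fun n => p.ne n b
  obtain ⟨x0, hx0⟩ := exists_glue t
  obtain ⟨f, hf⟩ := (hX.insert x0).exists_eq_range ⟨x0, Set.mem_insert _ _⟩
  obtain ⟨p', y, h1, h2, h3⟩ := g_step_aux p b G hG (fun j => Nat.casesOn j x0 f)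
    (fun n => by
      show bl n x0 ∈ _
      rw [hx0]; exact ht n)
  refine ⟨p', y, h1, h2, fun x hx => ?_⟩
  have : x ∈ Set.range f := hf ▸ Set.mem_insert_of_mem _ hx
  obtain ⟨j, rfl⟩ := this
  exact h3 (j + 1)

end GStep

section Transfinite

/-- The tasks of the transfinite construction. -/
abbrev SMTask : Type := Cantor ⊕ (Bool × {G : Set Cantor // MeasurableSet G ∧ μ G = 0})

lemma card_task (CH : Cardinal.continuum.{0} = Cardinal.aleph 1) :
    Cardinal.mk SMTask ≤ Cardinal.aleph 1 := by
  rw [← CH]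
  have h1 : Cardinal.mk Cantor ≤ Cardinal.continuum := by
    have : Cardinal.mk Cantor = Cardinal.mk (ZMod 2) ^ Cardinal.mk ℕ := by simp [Cantor]
    rw [this, Cardinal.mk_nat]
    have h2 : Cardinal.mk (ZMod 2) ≤ Cardinal.continuum := by
      have : Countable (ZMod 2) := Finite.to_countable
      exact (Cardinal.mk_le_aleph0).trans Cardinal.aleph0_le_continuum
    exact (Cardinal.power_le_power_right h2).trans Cardinal.continuum_power_aleph0.le
  have h3 : Cardinal.mk {G : Set Cantor | MeasurableSet G} ≤ Cardinal.continuum := by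
    have h := MeasurableSpace.cardinal_measurableSet_le_continuum
      (s := MeasurableSpace.countableGeneratingSet Cantor)
      ((Set.Countable.le_aleph0 (MeasurableSpace.countable_countableGeneratingSet)).trans
        Cardinal.aleph0_le_continuum)
    rwa [MeasurableSpace.generateFrom_countableGeneratingSet] at h
  have h4 : Cardinal.mk {G : Set Cantor // MeasurableSet G ∧ μ G = 0} ≤ Cardinal.continuum :=
    (Cardinal.mk_le_mk_of_subset (s := {G : Set Cantor | MeasurableSet G ∧ μ G = 0})
      (t := {G : Set Cantor | MeasurableSet G}) (fun G hG => hG.1)).trans h3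
  have h5 : Cardinal.mk Bool ≤ Cardinal.continuum :=
    (Cardinal.mk_le_aleph0).trans Cardinal.aleph0_le_continuum
  rw [Cardinal.mk_sum, Cardinal.mk_prod]
  simp only [Cardinal.lift_id]
  calc _ ≤ Cardinal.continuum + Cardinal.continuum * Cardinal.continuum :=
        add_le_add h1 (mul_le_mul' h5 h4)
    _ = Cardinal.continuum := by simp

/-- The state produced at each stage. -/
structure St where
  p : Cond
  b : Bool
  x : Cantor
  y : Cantor

/-- What a stage has to achieve. -/
def TSpec (r : SMTask → SMTask → Prop) (a : SMTask) (g : ∀ c, r c a → St) (s : St) : Prop :=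
  (∀ c h, Cle s.p (g c h).p) ∧
  (∀ z, a = Sum.inl z → s.x ∈ br s.p s.b ∧ s.x + z ∈ HH) ∧
  (∀ b G, a = Sum.inr (b, G) → (∀ x ∈ br s.p b, x + s.y ∉ G.1) ∧
    ∀ c h, (g c h).x + s.y ∉ G.1)

lemma tspec_exists (r : SMTask → SMTask → Prop) (a : SMTask) (g : ∀ c, r c a → St)
    (hc : {c | r c a}.Countable)
    (hch : ∀ c h c' h', Cle (g c h).p (g c' h').p ∨ Cle (g c' h').p (g c h).p) :
    ∃ s, TSpec r a g s := by
  have hcc : Countable {c // r c a} := hc.to_subtype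
  obtain ⟨p, hp⟩ : ∃ p, ∀ c h, Cle p (g c h).p := by
    by_cases hne : Nonempty {c // r c a}
    · obtain ⟨f, hf⟩ := exists_surjective_nat {c // r c a}
      obtain ⟨p, hp⟩ := lower_bound (fun i => (g (f i).1 (f i).2).p)
        (fun i j => hch _ _ _ _)
      refine ⟨p, fun c h => ?_⟩
      obtain ⟨i, hi⟩ := hf ⟨c, h⟩
      have := hp i
      simp only [hi] at this
      exact this
    · exact ⟨topC, fun c h => (hne ⟨⟨c, h⟩⟩).elim⟩
  rcases a with z | ⟨b, G⟩
  · obtain ⟨p', b, x, hle, hx, hz⟩ := z_step p z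
    refine ⟨⟨p', b, x, 0⟩, fun c h => hle.trans (hp c h), ?_, ?_⟩
    · intro z' hz'
      cases hz'
      exact ⟨hx, hz⟩
    · intro b G h
      cases h
  · obtain ⟨p', y, hle, h1, h2⟩ := g_step p b G.1 G.2.2
      (Set.range fun c : {c // r c (Sum.inr (b, G))} => (g c.1 c.2).x) (Set.countable_range _)
    refine ⟨⟨p', b, 0, y⟩, fun c h => hle.trans (hp c h), ?_, ?_⟩
    · intro z h
      cases h
    · intro b' G' h
      cases h
      exact ⟨h1, fun c h => h2 _ ⟨⟨c, h⟩, rfl⟩⟩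

lemma exists_construction (CH : Cardinal.continuum.{0} = Cardinal.aleph 1) :
    ∃ (r : SMTask → SMTask → Prop) (_ : IsWellOrder SMTask r) (F : SMTask → St),
      ∀ a, TSpec r a (fun c _ => F c) (F a) := by
  classical
  obtain ⟨r, hr, hord⟩ := Cardinal.exists_ord_eq SMTask
  refine ⟨r, hr, ?_⟩
  have hcount : ∀ a, {c | r c a}.Countable := by
    intro a
    rw [Cardinal.countable_iff_lt_aleph_one]
    exact (Cardinal.card_typein_lt a hord).trans_le (card_task CH)
  have wf : WellFounded r := IsWellFounded.wf
  let F : SMTask → St := wf.fix (fun a g =>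
    if h : ∃ s, TSpec r a g s then h.choose else ⟨topC, true, 0, 0⟩)
  have hF : ∀ a, F a = if h : ∃ s, TSpec r a (fun c _ => F c) s then h.choose
      else ⟨topC, true, 0, 0⟩ := fun a => wf.fix_eq _ a
  refine ⟨F, fun a => ?_⟩
  induction a using wf.induction with
  | _ a ih =>
    have hex : ∃ s, TSpec r a (fun c _ => F c) s := by
      refine tspec_exists r a _ (hcount a) ?_
      intro c h c' h'
      rcases trichotomous_of r c c' with h1 | h1 | h1
      · exact Or.inr ((ih c' h').1 c h1)
      · subst h1
        exact Or.inl (Cle.refl _)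
      · exact Or.inl ((ih c h).1 c' h1)
    rw [hF a, dif_pos hex]
    exact hex.choose_spec

end Transfinite

/-- Assuming CH, the collection of strongly meager sets is not an ideal. -/
theorem stronglyMeager_not_ideal
    (CH : Cardinal.continuum = Cardinal.aleph 1) :
    ∃ X₁ X₂ : Set Cantor, StronglyMeager X₁ ∧ StronglyMeager X₂ ∧
      ¬ StronglyMeager (X₁ ∪ X₂) := by
  have CH0 : Cardinal.continuum.{0} = Cardinal.aleph 1 := by
    apply Cardinal.lift_injective
    rw [Cardinal.lift_continuum, Cardinal.lift_aleph, Ordinal.lift_one]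
    exact CH
  obtain ⟨r, hr, F, hF⟩ := exists_construction CH0
  let X : Bool → Set Cantor := fun b => {x | ∃ z, (F (Sum.inl z)).b = b ∧ x = (F (Sum.inl z)).x}
  have hX : ∀ b, StronglyMeager (X b) := by
    intro b H hH heq
    obtain ⟨G, hHG, hGm, hG⟩ := exists_measurable_superset_of_null hH
    let a : SMTask := Sum.inr (b, ⟨G, hGm, hG⟩)
    obtain ⟨-, -, h3⟩ := hF a
    obtain ⟨h4, h5⟩ := h3 b _ rfl
    have hy : (F a).y ∈ X b + H := by rw [heq]; trivial
    obtain ⟨x, ⟨z, hzb, hx⟩, h, hh, hxy⟩ := Set.mem_add.1 hy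
    have hG' : x + (F a).y ∈ G := by
      rw [← hxy, ← add_assoc, c_add_self, zero_add]
      exact hHG hh
    rcases trichotomous_of r (Sum.inl z) a with h1 | h1 | h1
    · exact h5 _ h1 (hx ▸ hG')
    · exact absurd h1 (by simp [a])
    · obtain ⟨h6, h7, -⟩ := hF (Sum.inl z)
      have h8 := (h7 z rfl).1
      rw [hzb, ← hx] at h8
      exact h4 x (br_mono (h6 a h1) b h8) hG'
  refine ⟨X true, X false, hX true, hX false, fun hsm => ?_⟩
  refine hsm HH HH_null (Set.eq_univ_of_forall fun z => ?_)
  obtain ⟨-, h7, -⟩ := hF (Sum.inl z)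
  refine Set.mem_add.2 ⟨(F (Sum.inl z)).x, ?_, (F (Sum.inl z)).x + z, (h7 z rfl).2, ?_⟩
  · cases hb : (F (Sum.inl z)).b
    · exact Or.inr ⟨z, hb, rfl⟩
    · exact Or.inl ⟨z, hb, rfl⟩
  · rw [← add_assoc, c_add_self, zero_add]
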